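/- Let t ≥ 1 be an integer, p(n) the number of partitions of n, and set m_t(n) := √(6n)/π − t/2 and s_t(n) := ((π² − 6)√(6n)/(2π³))^{1/2}. Then the number N_t of hooks of length t, viewed as a statistic on all partitions of n, is asymptotically normally distributed with mean asymptotic to m_t(n) and variance asymptotic to s_t(n)²: for every x ∈ ℝ, lim_{n→∞} (1/p(n)) · #{λ ⊢ n : N_t(λ) ≤ m_t(n) + x·s_t(n)} = (1/√(2π)) ∫_{−∞}^{x} e^{−u²/2} du. -/

import Mathlib

open scoped Real Classical
open Complex Filter Asymptotics

noncomputable section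

/-- The conjugate part `λ'_k`: the number of parts of `P` that are at least `k`. -/
def colLen {n : ℕ} (P : n.Partition) (k : ℕ) : ℕ :=
  Multiset.card (P.parts.filter (fun p => k ≤ p))

/-- The part `λ_j` (the `j`-th largest part, 1-indexed), recovered by conjugating twice. -/
def rowLen {n : ℕ} (P : n.Partition) (j : ℕ) : ℕ :=
  ((Finset.Icc 1 n).filter (fun k => j ≤ colLen P k)).card

/-- The hook number `h(j,k) = (λ_j - j) + (λ'_k - k) + 1` of the cell `(j,k)` (1-indexed). -/
def hookNum {n : ℕ} (P : n.Partition) (j k : ℕ) : ℤ :=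
  ((rowLen P j : ℤ) - j) + ((colLen P k : ℤ) - k) + 1

/-- `N_t(λ)`: the number of cells of the Young diagram of `λ` with hook number `t`. -/
def Nhook {n : ℕ} (t : ℕ) (P : n.Partition) : ℕ :=
  (((Finset.Icc 1 n) ×ˢ (Finset.Icc 1 n)).filter
    (fun c => c.2 ≤ rowLen P c.1 ∧ hookNum P c.1 c.2 = (t : ℤ))).card

/-- A partition is self-conjugate if `λ_k = λ'_k` for all `k ≥ 1`. -/
def IsSelfConjugate {n : ℕ} (P : n.Partition) : Prop :=
  ∀ k, 1 ≤ k → rowLen P k = colLen P k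

/-- `SC(n)`, the set of self-conjugate partitions of `n`. -/
def SC (n : ℕ) : Finset (Nat.Partition n) :=
  Finset.univ.filter (fun P => IsSelfConjugate P)

/-- `δ_t = 1` if `t` is odd, else `0`. -/
def delta (t : ℕ) : ℝ := if Odd t then 1 else 0

/-- The region `D_θ = { r e^{iα} : r ≥ 0, |α| ≤ θ }`. -/
def Dset (θ : ℝ) : Set ℂ := {z | z = 0 ∨ |z.arg| ≤ θ}

/-- The filter of punctured neighborhoods of `0` intersected with `D_θ`. -/
def near0 (θ : ℝ) : Filter ℂ := nhdsWithin 0 (Dset θ \ {0})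

/-- The dilogarithm `Li₂(X) = -∫₀¹ log(1 - Xu)/u du` (principal logarithm). -/
def Li2 (X : ℂ) : ℂ := -∫ u in (0:ℝ)..1, Complex.log (1 - X * u) / (u : ℂ)

/-- The real dilogarithm, for real arguments `x < 1`. -/
def Li2R (x : ℝ) : ℝ := -∫ u in (0:ℝ)..1, Real.log (1 - x * u) / u

/-- The principal complex square root. -/
def csqrt (z : ℂ) : ℂ := z ^ ((1:ℂ)/2)

/-- The infinite Pochhammer symbol `(a;q)_∞ = ∏_{j ≥ 0} (1 - a q^j)`. -/
def pochInf (a q : ℂ) : ℂ := ∏' j : ℕ, (1 - a * q ^ j)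

/-- The finite Pochhammer symbol `(a;q)_n = ∏_{j=0}^{n-1} (1 - a q^j)`. -/
def pochN (a q : ℂ) (n : ℕ) : ℂ := ∏ j ∈ Finset.range n, (1 - a * q ^ j)

/-- `C_T^+ = 1 + √((1-T)/(1+T))`. -/
def Cp (T : ℝ) : ℂ := 1 + csqrt ((1 - (T:ℂ)) / (1 + (T:ℂ)))

/-- `C_T^- = 1 - √((1-T)/(1+T))`. -/
def Cm (T : ℝ) : ℂ := 1 - csqrt ((1 - (T:ℂ)) / (1 + (T:ℂ)))

/-- `H*(T;q) = (1/(2T)) [ C_T^+ (√(1-T²);-q)_∞ + C_T^- (-√(1-T²);-q)_∞ ]`. -/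
def Hstar (T : ℝ) (q : ℂ) : ℂ :=
  1 / (2 * (T:ℂ)) * (Cp T * pochInf (csqrt (1 - (T:ℂ)^2)) (-q)
    + Cm T * pochInf (-csqrt (1 - (T:ℂ)^2)) (-q))

/-- `α_T^+ = (1/(2T)) ( C_T^+ + C_T^- √((1+√(1-T²))/(1-√(1-T²))) )`. -/
def alphaP (T : ℝ) : ℂ :=
  1 / (2 * (T:ℂ)) *
    (Cp T + Cm T * csqrt ((1 + csqrt (1 - (T:ℂ)^2)) / (1 - csqrt (1 - (T:ℂ)^2))))

/-- `α_T^- = (1/(2T)) ( C_T^+ - C_T^- √((1+√(1-T²))/(1-√(1-T²))) )`. -/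
def alphaM (T : ℝ) : ℂ :=
  1 / (2 * (T:ℂ)) *
    (Cp T - Cm T * csqrt ((1 + csqrt (1 - (T:ℂ)^2)) / (1 - csqrt (1 - (T:ℂ)^2))))

/-- `b_t(T)` from Proposition: saddle-point constant. -/
def bt (t : ℕ) (T : ℝ) : ℝ :=
  if Even t then (1/2) * Real.sqrt (π^2/6 - Li2R (1 - T^2))
  else (1/2) * Real.sqrt (π^2/6 - ((t-1 : ℝ)/t) * Li2R (1 - T^2))

end

namespace PartitionHooks

section Diagram

lemma lt_card_filter_range_iff {f : ℕ → ℕ} (hf : Antitone f) {K : ℕ} (hK : ∀ k, K ≤ k → f k = 0)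
    (j k : ℕ) : k < ((Finset.range K).filter (fun i => j < f i)).card ↔ j < f k := by
  constructor
  · contrapose!
    intro h
    calc _ ≤ (Finset.range k).card := Finset.card_le_card ?_
      _ = k := Finset.card_range k
    intro i hi
    simp only [Finset.mem_filter, Finset.mem_range] at hi ⊢
    by_contra! hc
    have := hf hc
    omega
  · intro h
    calc k < (Finset.range (k + 1)).card := by simp
      _ ≤ _ := Finset.card_le_card ?_
    intro i hi
    simp only [Finset.mem_filter, Finset.mem_range] at hi ⊢
    have h1 := hf (Nat.lt_succ_iff.mp hi)
    refine ⟨?_, by omega⟩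
    by_contra! hc
    have := hK i hc
    omega

variable {n : ℕ} (P : n.Partition)

lemma colLen_antitone : Antitone (colLen P) := fun _ _ h =>
  Multiset.card_le_card (Multiset.monotone_filter_right _ fun _ hb => h.trans hb)

lemma colLen_eq_zero {k : ℕ} (h : n < k) : colLen P k = 0 := by
  unfold colLen
  rw [Multiset.card_eq_zero, Multiset.filter_eq_nil]
  intro a ha hk
  have := P.le_of_mem_parts ha
  omega

lemma card_parts_le : Multiset.card P.parts ≤ n := by
  conv_rhs => rw [← P.parts_sum]
  have := Multiset.card_nsmul_le_sum (s := P.parts) (a := 1) (fun x hx => P.parts_pos hx)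
  simpa using this

lemma colLen_le (k : ℕ) : colLen P k ≤ n :=
  (Multiset.card_le_card (Multiset.filter_le _ _)).trans (card_parts_le P)

lemma le_rowLen_iff {j k : ℕ} (hj : 1 ≤ j) (hk : 1 ≤ k) : k ≤ rowLen P j ↔ j ≤ colLen P k := by
  have h := lt_card_filter_range_iff (f := fun i => colLen P (i + 1)) (K := n)
    (fun a b h => colLen_antitone P (Nat.succ_le_succ h))
    (fun k hk => colLen_eq_zero P (Nat.lt_succ_of_le hk)) (j - 1) (k - 1)
  have e : rowLen P j
      = ((Finset.range n).filter (fun i => j - 1 < colLen P (i + 1))).card := by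
    unfold rowLen
    symm
    refine Finset.card_bij (fun i _ => i + 1) ?_ ?_ ?_
    · intro a ha
      simp only [Finset.mem_filter, Finset.mem_range, Finset.mem_Icc] at ha ⊢
      omega
    · intro a _ b _ h
      omega
    · intro b hb
      simp only [Finset.mem_filter, Finset.mem_Icc] at hb
      refine ⟨b - 1, ?_, by omega⟩
      have : b - 1 + 1 = b := by omega
      simp only [Finset.mem_filter, Finset.mem_range, this]
      omega
  rw [e]
  have : k - 1 + 1 = k := by omega
  simp only [this] at h
  omega

lemma rowLen_le (j : ℕ) : rowLen P j ≤ n := by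
  unfold rowLen
  exact (Finset.card_filter_le _ _).trans (by simp)

lemma rowLen_succ_le {j : ℕ} (hj : 1 ≤ j) : rowLen P (j + 1) ≤ rowLen P j := by
  rcases Nat.eq_zero_or_pos (rowLen P (j + 1)) with h | h
  · omega
  · rw [le_rowLen_iff P hj h]
    have := (le_rowLen_iff P (j := j + 1) (by omega) h).1 le_rfl
    omega

lemma rowLen_anti {j j' : ℕ} (hj : 1 ≤ j) (h : j ≤ j') : rowLen P j' ≤ rowLen P j := by
  induction j', h using Nat.le_induction with
  | base => exact le_rfl
  | succ m hm ih => exact (rowLen_succ_le P (hj.trans hm)).trans ih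

lemma sum_colLen {L : ℕ} (hL : n ≤ L) :
    ∑ k ∈ Finset.range L, colLen P (k + 1) = n := by
  have key : ∀ s : Multiset ℕ, (∀ p ∈ s, p ≤ L) →
      ∑ k ∈ Finset.range L, Multiset.card (s.filter (fun p => k + 1 ≤ p)) = s.sum := by
    intro s
    induction s using Multiset.induction with
    | empty => simp
    | cons a s ih =>
      intro h
      have ha : a ≤ L := h a (by simp)
      have : ∀ k, Multiset.card ((a ::ₘ s).filter (fun p => k + 1 ≤ p))
          = (if k < a then 1 else 0) + Multiset.card (s.filter (fun p => k + 1 ≤ p)) := by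
        intro k
        by_cases hk : k + 1 ≤ a
        · rw [Multiset.filter_cons_of_pos _ hk, if_pos (by omega)]; simp [add_comm]
        · rw [Multiset.filter_cons_of_neg _ hk, if_neg (by omega)]; simp
      simp only [this, Finset.sum_add_distrib]
      rw [ih (fun p hp => h p (by simp [hp])), Multiset.sum_cons]
      congr 1
      rw [← Finset.card_filter]
      have : (Finset.range L).filter (fun k => k < a) = Finset.range a := by
        ext k; simp; omega
      rw [this, Finset.card_range]
  have := key P.parts (fun p hp => (P.le_of_mem_parts hp).trans hL)
  rw [P.parts_sum] at this
  exact this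

lemma count_parts_add (k : ℕ) :
    P.parts.count k + colLen P (k + 1) = colLen P k := by
  have key : ∀ s : Multiset ℕ, s.count k + Multiset.card (s.filter (fun p => k + 1 ≤ p))
      = Multiset.card (s.filter (fun p => k ≤ p)) := by
    intro s
    induction s using Multiset.induction with
    | empty => simp
    | cons a s ih =>
      rw [Multiset.count_cons]
      rcases lt_trichotomy a k with h | h | h
      · rw [Multiset.filter_cons_of_neg _ (by omega), Multiset.filter_cons_of_neg _ (by omega),
          if_neg (by omega)]
        omega
      · rw [Multiset.filter_cons_of_neg _ (by omega), Multiset.filter_cons_of_pos _ (by omega),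
          if_pos (by omega), Multiset.card_cons]
        omega
      · rw [Multiset.filter_cons_of_pos _ (by omega), Multiset.filter_cons_of_pos _ (by omega),
          if_neg (by omega), Multiset.card_cons, Multiset.card_cons]
        omega
  exact key P.parts

lemma exists_partition_colLen {f : ℕ → ℕ} (hf : Antitone f) {K : ℕ}
    (hK : ∀ k, K ≤ k → f k = 0) :
    ∃ (n : ℕ) (P : n.Partition), ∀ k, colLen P (k + 1) = f k := by
  let s : Multiset ℕ := (Multiset.range (f 0)).map
    (fun j => ((Finset.range K).filter (fun i => j < f i)).card)
  have hs : ∀ {i}, i ∈ s → 0 < i := by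
    intro i hi
    obtain ⟨j, hj, rfl⟩ := Multiset.mem_map.1 hi
    exact (lt_card_filter_range_iff hf hK j 0).2 (Multiset.mem_range.1 hj)
  refine ⟨s.sum, ⟨s, hs, rfl⟩, fun k => ?_⟩
  have h0 : f k ≤ f 0 := hf (Nat.zero_le k)
  have hr : Multiset.filter (fun j => j < f k) (Multiset.range (f 0)) = Multiset.range (f k) := by
    have : (Finset.range (f 0)).filter (fun j => j < f k) = Finset.range (f k) := by
      ext j; simp; omega
    exact congrArg Finset.val this
  simp only [colLen, s, Multiset.filter_map, Multiset.card_map, Function.comp_def,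
    Nat.succ_le_iff, lt_card_filter_range_iff hf hK, hr, Multiset.card_range]

end Diagram

section Maya

/-- The position of the `k`-th gap (0-indexed) of the Maya diagram of charge `c` of `P`. -/
def gap {n : ℕ} (P : n.Partition) (c : ℤ) (k : ℕ) : ℤ := k + c - colLen P (k + 1)

lemma gap_strictMono {n : ℕ} (P : n.Partition) (c : ℤ) : StrictMono (gap P c) := by
  refine strictMono_nat_of_lt_succ fun k => ?_
  have := colLen_antitone P (show k + 1 ≤ k + 1 + 1 by omega)
  unfold gap
  push_cast
  omega

lemma gap_of_le {n : ℕ} (P : n.Partition) (c : ℤ) {k : ℕ} (hk : n ≤ k) : gap P c k = k + c := by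
  simp [gap, colLen_eq_zero P (Nat.lt_succ_of_le hk)]

/-- The positions that are not gaps are the beads `λ_j - j + c`. -/
lemma notMem_range_gap_iff {n : ℕ} (P : n.Partition) (c i : ℤ) :
    i ∉ Set.range (gap P c) ↔ ∃ j : ℕ, 1 ≤ j ∧ (rowLen P j : ℤ) - j + c = i := by
  constructor
  · intro h
    have hex : ∃ j : ℕ, 1 ≤ j ∧ (rowLen P j : ℤ) - j + c ≤ i := by
      refine ⟨(n + c - i).toNat + 1, by omega, ?_⟩
      have := rowLen_le P ((n + c - i).toNat + 1)
      push_cast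
      omega
    let j := Nat.find hex
    obtain ⟨hj1, hj2⟩ := Nat.find_spec hex
    refine ⟨j, hj1, le_antisymm hj2 ?_⟩
    by_contra! hlt
    apply h
    have hjpos : 0 ≤ i - c + j := by
      change (rowLen P j : ℤ) - j + c < i at hlt
      omega
    obtain ⟨k, hk⟩ : ∃ k : ℕ, (k : ℤ) = i - c + j - 1 := by
      refine ⟨(i - c + j - 1).toNat, ?_⟩
      change (rowLen P j : ℤ) - j + c < i at hlt
      omega
    refine ⟨k, ?_⟩
    have h1 : ¬ (k + 1 ≤ rowLen P j) := by
      change (rowLen P j : ℤ) - j + c < i at hlt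
      omega
    rw [le_rowLen_iff P hj1 (by omega)] at h1
    have h2 : j - 1 ≤ colLen P (k + 1) := by
      rcases Nat.eq_or_lt_of_le hj1 with h | h
      · change 1 = j at h
        omega
      · have hj' : 1 ≤ j - 1 := by change 1 < j at h; omega
        have := Nat.find_min hex (m := j - 1) (by change j - 1 < j; omega)
        simp only [not_and, not_le] at this
        rw [← le_rowLen_iff P hj' (by omega)]
        have := this hj'
        change i < (rowLen P (j - 1) : ℤ) - ((j - 1 : ℕ) : ℤ) + c at this
        omega
    change 1 ≤ j at hj1
    unfold gap
    omega
  · rintro ⟨j, hj, rfl⟩ ⟨k, hk⟩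
    have := le_rowLen_iff P hj (k := k + 1) (by omega)
    unfold gap at hk
    by_cases h : j ≤ colLen P (k + 1)
    · have := this.2 h
      omega
    · have := this.not.2 h
      omega

/-- Maya diagrams, represented by their sets of gaps. -/
def Maya : Type := {U : Set ℤ // (∃ a, ∀ i < a, i ∉ U) ∧ ∃ b, ∀ i, b ≤ i → i ∈ U}

/-- The Maya diagram with charge `c` attached to a partition. -/
def encode (x : (Σ n, Nat.Partition n) × ℤ) : Maya :=
  ⟨Set.range (gap x.1.2 x.2), by
    refine ⟨⟨gap x.1.2 x.2 0, ?_⟩, ⟨x.1.1 + x.2, ?_⟩⟩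
    · rintro _ hi ⟨k, rfl⟩
      exact absurd ((gap_strictMono x.1.2 x.2).monotone (Nat.zero_le k)) (not_le.2 hi)
    · intro i hi
      refine ⟨(i - x.2).toNat, ?_⟩
      rw [gap_of_le _ _ (by omega)]
      omega⟩

lemma encode_injective : Function.Injective encode := by
  rintro ⟨⟨n, P⟩, c⟩ ⟨⟨m, Q⟩, d⟩ h
  have h1 : gap P c = gap Q d :=
    (StrictMono.range_inj (gap_strictMono P c) (gap_strictMono Q d)).1 (congrArg Subtype.val h)
  have hcd : c = d := by
    have := congrFun h1 (max n m)
    rw [gap_of_le P c (le_max_left _ _), gap_of_le Q d (le_max_right _ _)] at this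
    omega
  subst hcd
  have hcol : ∀ k, colLen P (k + 1) = colLen Q (k + 1) := by
    intro k
    have := congrFun h1 k
    unfold gap at this
    omega
  have hparts : P.parts = Q.parts := by
    ext k
    rcases k with _ | k
    · rw [Multiset.count_eq_zero_of_notMem fun h => lt_irrefl _ (P.parts_pos h),
        Multiset.count_eq_zero_of_notMem fun h => lt_irrefl _ (Q.parts_pos h)]
    · have h2 := count_parts_add P (k + 1)
      have h3 := count_parts_add Q (k + 1)
      have := hcol k
      have := hcol (k + 1)
      omega
  have hnm : n = m := by rw [← P.parts_sum, ← Q.parts_sum, hparts]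
  subst hnm
  have : P = Q := Nat.Partition.ext hparts
  subst this
  rfl

lemma encode_surjective : Function.Surjective encode := by
  rintro ⟨U, ⟨a, ha⟩, ⟨b, hb⟩⟩
  let p : ℕ → Prop := fun m => a + m ∈ U
  let B : ℕ := (b - a).toNat
  have hp : ∀ m, B ≤ m → p m := fun m hm => hb _ (by omega)
  have hinf : {m | p m}.Infinite :=
    Set.infinite_of_not_bddAbove fun ⟨M, hM⟩ => by
      have := hM (show max B (M + 1) ∈ {m | p m} from hp _ (le_max_left _ _))
      omega
  have hmono : StrictMono (Nat.nth p) := Nat.nth_strictMono hinf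
  let k₀ := Nat.count p B
  have hcount : ∀ m, Nat.count p (B + m) = k₀ + m := by
    intro m
    induction m with
    | zero => rfl
    | succ m ih => rw [← add_assoc, Nat.count_succ, ih, if_pos (hp _ (by omega))]; ring
  have hnth : ∀ m, Nat.nth p (k₀ + m) = B + m := by
    intro m
    rw [← hcount, Nat.nth_count (hp _ (by omega))]
  let c : ℤ := a + B - k₀
  have hstep : ∀ k, Nat.nth p k + 1 ≤ Nat.nth p (k + 1) := fun k => hmono (Nat.lt_succ_self k)
  let F : ℕ → ℤ := fun k => k + c - (a + Nat.nth p k)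
  have hF : Antitone F := antitone_nat_of_succ_le fun k => by
    have := hstep k
    simp only [F]
    push_cast
    omega
  have hF0 : ∀ k, k₀ ≤ k → F k = 0 := by
    intro k hk
    obtain ⟨m, rfl⟩ := Nat.exists_eq_add_of_le hk
    simp only [F, hnth, c]
    push_cast
    ring
  have hFnn : ∀ k, 0 ≤ F k := fun k => by
    rw [← hF0 (max k k₀) (le_max_right _ _)]
    exact hF (le_max_left _ _)
  obtain ⟨n, P, hP⟩ := exists_partition_colLen (f := fun k => (F k).toNat)
    (fun x y h => Int.toNat_le_toNat (hF h)) (K := k₀) (fun k hk => by simp [hF0 k hk])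
  refine ⟨(⟨n, P⟩, c), Subtype.ext ?_⟩
  have hg : ∀ k, gap P c k = a + Nat.nth p k := by
    intro k
    have := hFnn k
    rw [gap, hP, Int.toNat_of_nonneg this]
    simp only [F]
    ring
  change Set.range (gap P c) = U
  ext i
  constructor
  · rintro ⟨k, rfl⟩
    rw [hg]
    exact Nat.nth_mem_of_infinite hinf k
  · intro hi
    have hai : a ≤ i := by
      by_contra! h
      exact ha i h hi
    have hpi : p (i - a).toNat := by
      change a + ((i - a).toNat : ℤ) ∈ U
      rwa [Int.toNat_of_nonneg (by omega), add_sub_cancel]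
    refine ⟨Nat.count p (i - a).toNat, ?_⟩
    rw [hg, Nat.nth_count hpi]
    omega

/-- Charged partitions correspond to Maya diagrams. -/
noncomputable def encodeEquiv : (Σ n, Nat.Partition n) × ℤ ≃ Maya :=
  Equiv.ofBijective encode ⟨encode_injective, encode_surjective⟩

end Maya

section Split

variable (t : ℕ) [NeZero t]

/-- The Maya diagrams obtained by reading the positions in each residue class modulo `t`. -/
def split : Maya ≃ (Fin t → Maya) where
  toFun U r := ⟨{j | j * t + (r : ℕ) ∈ U.1}, by
    obtain ⟨⟨a, ha⟩, ⟨b, hb⟩⟩ := U.2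
    have ht : (1 : ℤ) ≤ t := by exact_mod_cast NeZero.one_le
    have hr : ((r : ℕ) : ℤ) < t := by exact_mod_cast r.2
    refine ⟨⟨min (a - t) 0, fun i hi => ha _ ?_⟩, ⟨max b 0, fun i hi => hb _ ?_⟩⟩
    · have h1 : i < a - t := lt_of_lt_of_le hi (min_le_left _ _)
      have h2 : i < 0 := lt_of_lt_of_le hi (min_le_right _ _)
      nlinarith
    · have h1 : b ≤ i := (le_max_left _ _).trans hi
      have h2 : 0 ≤ i := (le_max_right _ _).trans hi
      nlinarith⟩
  invFun V := ⟨{i | i / t ∈ (V (Int.divModEquiv t i).2).1}, by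
    have h := fun r => (V r).2
    choose hA hB using h
    choose a ha using hA
    choose b hb using hB
    have ht : (1 : ℤ) ≤ t := by exact_mod_cast NeZero.one_le
    obtain ⟨A, hA⟩ := (Set.finite_range a).bddBelow
    obtain ⟨B, hB⟩ := (Set.finite_range b).bddAbove
    refine ⟨⟨A * t, fun i hi => ha _ _ ?_⟩, ⟨B * t, fun i hi => hb _ _ ?_⟩⟩
    · refine lt_of_lt_of_le ?_ (hA ⟨_, rfl⟩)
      exact Int.ediv_lt_of_lt_mul (by omega) hi
    · refine le_trans (hB ⟨_, rfl⟩) ?_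
      exact (Int.le_ediv_iff_mul_le (by omega)).2 hi⟩
  left_inv U := by
    refine Subtype.ext ?_
    ext i
    change (Int.divModEquiv t).symm (Int.divModEquiv t i) ∈ U.1 ↔ _
    rw [Equiv.symm_apply_apply]
  right_inv V := by
    funext r
    refine Subtype.ext ?_
    ext j
    change (Int.divModEquiv t ((Int.divModEquiv t).symm (j, r))).1 ∈
      (V (Int.divModEquiv t ((Int.divModEquiv t).symm (j, r))).2).1 ↔ _
    rw [Equiv.apply_symm_apply]

lemma mem_split {U : Maya} {r : Fin t} {j : ℤ} :
    j ∈ (split t U r).1 ↔ j * t + (r : ℕ) ∈ U.1 := Iff.rfl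

lemma finsum_int_eq_sum_residues {f : ℤ → ℤ} (hf : (Function.support f).Finite) :
    ∑ᶠ i, f i = ∑ r : Fin t, ∑ᶠ j : ℤ, f (j * t + (r : ℕ)) := by
  let e : Fin t × ℤ ≃ ℤ := (Equiv.prodComm _ _).trans (Int.divModEquiv t).symm
  rw [← finsum_comp_equiv e, finsum_curry, finsum_eq_sum_of_fintype]
  · rfl
  · exact hf.preimage e.injective.injOn

/-- The sum of `g` over nonnegative positions minus the sum over gaps, suitably interpreted. -/
noncomputable def moment (U : Maya) (g : ℤ → ℤ) : ℤ :=
  ∑ᶠ i : ℤ, ((if 0 ≤ i then 1 else 0) - (if i ∈ U.1 then 1 else 0)) * g i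

/-- The number of pairs formed by a gap and a bead `t` places above it. -/
noncomputable def hookCount (t : ℕ) (U : Maya) : ℤ :=
  ∑ᶠ i : ℤ, if i ∈ U.1 ∧ i + t ∉ U.1 then 1 else 0

lemma finite_support_of_zero_outside {f : ℤ → ℤ} (a b : ℤ) (h : ∀ i, i < a → f i = 0)
    (h' : ∀ i, b ≤ i → f i = 0) : (Function.support f).Finite := by
  refine (Set.finite_Ico a b).subset fun i hi => ?_
  by_contra hc
  simp only [Set.mem_Ico, not_and_or, not_le, not_lt] at hc
  exact hi (hc.elim (h i) (h' i))

lemma moment_finite (U : Maya) (g : ℤ → ℤ) : (Function.support fun i : ℤ =>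
    ((if 0 ≤ i then 1 else 0) - (if i ∈ U.1 then 1 else 0)) * g i).Finite := by
  obtain ⟨⟨a, ha⟩, ⟨b, hb⟩⟩ := U.2
  refine finite_support_of_zero_outside (min a 0) (max b 0) ?_ ?_
  · intro i hi
    rw [if_neg (not_le.2 (lt_of_lt_of_le hi (min_le_right _ _))),
      if_neg (ha _ (lt_of_lt_of_le hi (min_le_left _ _)))]
    simp
  · intro i hi
    rw [if_pos ((le_max_right _ _).trans hi), if_pos (hb _ ((le_max_left _ _).trans hi))]
    simp

lemma moment_add (U : Maya) (g h : ℤ → ℤ) :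
    moment U (fun i => g i + h i) = moment U g + moment U h := by
  unfold moment
  rw [← finsum_add_distrib (moment_finite U g) (moment_finite U h)]
  simp only [mul_add]

lemma moment_const_mul (U : Maya) (a : ℤ) (g : ℤ → ℤ) :
    moment U (fun i => a * g i) = a * moment U g := by
  unfold moment
  rw [mul_finsum]
  exact finsum_congr fun i => by ring

lemma moment_split (U : Maya) (g : ℤ → ℤ) :
    moment U g = ∑ r : Fin t, moment (split t U r) (fun j => g (j * t + (r : ℕ))) := by
  unfold moment
  rw [finsum_int_eq_sum_residues t (moment_finite U g)]
  refine Finset.sum_congr rfl fun r _ => finsum_congr fun j => ?_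
  have ht : (1 : ℤ) ≤ t := by exact_mod_cast NeZero.one_le
  have hr : ((r : ℕ) : ℤ) < t := by exact_mod_cast r.2
  have : (0 ≤ j * t + ((r : ℕ) : ℤ)) ↔ 0 ≤ j := by
    constructor
    · intro h
      by_contra! hc
      nlinarith
    · intro h
      positivity
  simp only [this, mem_split]

lemma hookCount_split (U : Maya) : hookCount t U = ∑ r : Fin t, hookCount 1 (split t U r) := by
  unfold hookCount
  rw [finsum_int_eq_sum_residues t]
  · refine Finset.sum_congr rfl fun r _ => finsum_congr fun j => ?_
    simp only [mem_split]
    have : (j + ((1 : ℕ) : ℤ)) * t + ((r : ℕ) : ℤ) = j * t + ((r : ℕ) : ℤ) + t := by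
      push_cast; ring
    rw [this]
  · obtain ⟨⟨a, ha⟩, ⟨b, hb⟩⟩ := U.2
    refine finite_support_of_zero_outside a b ?_ ?_
    · intro i hi
      rw [if_neg fun h => ha i hi h.1]
    · intro i hi
      rw [if_neg fun h => h.2 (hb _ (by omega))]

lemma sum_Ico_int (N : ℕ) (g : ℤ → ℤ) :
    ∑ i ∈ Finset.Ico (0 : ℤ) N, g i = ∑ k ∈ Finset.range N, g k := by
  symm
  refine Finset.sum_bij (fun k _ => (k : ℤ)) ?_ ?_ ?_ ?_
  · intro k hk
    simp at hk ⊢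
    exact hk
  · intro a _ b _ h
    exact_mod_cast h
  · intro b hb
    simp only [Finset.mem_Ico] at hb
    exact ⟨b.toNat, by simp; omega, by omega⟩
  · intros
    rfl

lemma moment_encode {n : ℕ} (P : n.Partition) (c : ℤ) (g : ℤ → ℤ) (L N : ℕ) (hL : n ≤ L)
    (hN : (N : ℤ) = L + c) (hL' : - (L : ℤ) ≤ c - n) :
    moment (encode (⟨n, P⟩, c)) g
      = ∑ k ∈ Finset.range N, g k - ∑ k ∈ Finset.range L, g (gap P c k) := by
  have hgap0 : ∀ k, -(L : ℤ) ≤ gap P c k := fun k => by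
    refine le_trans ?_ ((gap_strictMono P c).monotone (Nat.zero_le k))
    have := colLen_le P 1
    simp only [gap]
    push_cast
    omega
  have hgapL : ∀ k, gap P c k < N ↔ k < L := fun k => by
    rw [hN, ← gap_of_le P c hL]
    exact (gap_strictMono P c).lt_iff_lt
  have hup : ∀ i, (N : ℤ) ≤ i → i ∈ (encode (⟨n, P⟩, c)).1 := fun i hi => by
    refine ⟨(i - c).toNat, ?_⟩
    change gap P c _ = i
    rw [gap_of_le _ _ (by omega)]
    omega
  unfold moment
  rw [finsum_eq_sum_of_support_subset (s := Finset.Ico (-(L : ℤ)) N)]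
  · simp only [sub_mul, Finset.sum_sub_distrib, ite_mul, one_mul, zero_mul, ← Finset.sum_filter]
    congr 1
    · rw [← sum_Ico_int]
      refine Finset.sum_congr ?_ fun _ _ => rfl
      ext i
      simp
    · have : Finset.filter (fun i => i ∈ (encode (⟨n, P⟩, c)).1) (Finset.Ico (-(L : ℤ)) N)
          = (Finset.range L).image (gap P c) := by
        ext i
        simp only [Finset.mem_filter, Finset.mem_Ico, Finset.mem_image, Finset.mem_range]
        constructor
        · rintro ⟨⟨_, h2⟩, k, rfl⟩
          exact ⟨k, (hgapL k).1 h2, rfl⟩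
        · rintro ⟨k, hk, rfl⟩
          exact ⟨⟨hgap0 k, (hgapL k).2 hk⟩, k, rfl⟩
      rw [this, Finset.sum_image fun x _ y _ h => (gap_strictMono P c).injective h]
  · intro i hi
    by_contra hc
    simp only [Finset.coe_Ico, Set.mem_Ico, not_and_or, not_le, not_lt] at hc
    apply hi
    rcases hc with hc | hc
    · have h2 : i ∉ (encode (⟨n, P⟩, c)).1 := by
        rintro ⟨k, rfl⟩
        exact absurd (hgap0 k) (not_le.2 hc)
      simp only [if_neg h2, if_neg (show ¬ 0 ≤ i by omega)]
      simp
    · simp only [if_pos (hup i hc), if_pos (show 0 ≤ i by omega)]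
      simp

lemma moment_encode_one (x : (Σ n, Nat.Partition n) × ℤ) :
    moment (encode x) (fun _ => 1) = x.2 := by
  obtain ⟨⟨n, P⟩, c⟩ := x
  have := moment_encode P c (fun _ => 1) (n + c.natAbs) (n + c.natAbs + c).toNat
    (by omega) (by omega) (by omega)
  rw [this]
  simp only [Finset.sum_const, Finset.card_range, nsmul_eq_mul, mul_one]
  omega

lemma two_mul_sum_range (N : ℕ) : 2 * ∑ k ∈ Finset.range N, (k : ℤ) = N * (N - 1) := by
  induction N with
  | zero => simp
  | succ N ih => rw [Finset.sum_range_succ, mul_add, ih]; push_cast; ring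

lemma two_mul_moment_encode_id (x : (Σ n, Nat.Partition n) × ℤ) :
    2 * moment (encode x) (fun i => i) = 2 * x.1.1 + x.2 * (x.2 - 1) := by
  obtain ⟨⟨n, P⟩, c⟩ := x
  have hN : (((n + c.natAbs + c).toNat : ℕ) : ℤ) = ((n + c.natAbs : ℕ) : ℤ) + c := by
    omega
  have := moment_encode P c (fun i => i) (n + c.natAbs) (n + c.natAbs + c).toNat
    (by omega) hN (by omega)
  rw [this, mul_sub, two_mul_sum_range, hN]
  simp only [gap, Finset.sum_sub_distrib, Finset.sum_add_distrib, mul_sub, mul_add,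
    two_mul_sum_range]
  rw [← Nat.cast_sum, sum_colLen P (by omega)]
  simp
  ring

lemma hookCount_encode (x : (Σ n, Nat.Partition n) × ℤ) (t : ℕ) (ht : 1 ≤ t) :
    hookCount t (encode x) = Nhook t x.1.2 := by
  obtain ⟨⟨n, P⟩, c⟩ := x
  unfold hookCount Nhook
  simp only
  have hmem : ∀ i, i ∈ (encode (⟨n, P⟩, c)).1 ↔ i ∈ Set.range (gap P c) := fun i => Iff.rfl
  let S := (((Finset.Icc 1 n) ×ˢ (Finset.Icc 1 n)).filter
    (fun c : ℕ × ℕ => c.2 ≤ rowLen P c.1 ∧ hookNum P c.1 c.2 = (t : ℤ)))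
  have hS : ∀ i, (i ∈ (encode (⟨n, P⟩, c)).1 ∧ i + t ∉ (encode (⟨n, P⟩, c)).1) ↔
      i ∈ S.image (fun z => gap P c (z.2 - 1)) := by
    intro i
    rw [hmem, hmem, notMem_range_gap_iff]
    simp only [S, Finset.mem_image, Finset.mem_filter, Finset.mem_product, Finset.mem_Icc,
      Prod.exists]
    constructor
    · rintro ⟨⟨k, rfl⟩, j, hj, h⟩
      have hh : hookNum P j (k + 1) = t := by
        unfold gap at h
        unfold hookNum
        push_cast
        omega
      have hle : k + 1 ≤ rowLen P j := by
        by_contra hc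
        have h2 := (le_rowLen_iff P hj (k := k + 1) (by omega)).not.1 hc
        unfold hookNum at hh
        push_cast at hh
        omega
      have hle2 := (le_rowLen_iff P hj (k := k + 1) (by omega)).1 hle
      exact ⟨j, k + 1, ⟨⟨⟨hj, hle2.trans (colLen_le P _)⟩, by omega, hle.trans (rowLen_le P j)⟩,
        hle, hh⟩, by simp⟩
    · rintro ⟨j, k, ⟨⟨⟨hj, _⟩, hk, _⟩, _, hh⟩, rfl⟩
      refine ⟨⟨k - 1, rfl⟩, j, hj, ?_⟩
      unfold hookNum at hh
      unfold gap
      have : k - 1 + 1 = k := by omega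
      rw [this, Nat.cast_sub hk]
      push_cast
      omega
  have hfin := finsum_eq_sum_of_support_subset (s := S.image (fun z => gap P c (z.2 - 1)))
    (f := fun i : ℤ => if (i ∈ (encode (⟨n, P⟩, c)).1 ∧ i + t ∉ (encode (⟨n, P⟩, c)).1)
      then (1 : ℤ) else 0) (by
        intro i hi
        rw [Finset.mem_coe, ← hS]
        by_contra hc
        exact hi (if_neg hc))
  rw [hfin, Finset.sum_congr rfl fun i hi => if_pos ((hS i).2 hi), Finset.sum_const,
    Finset.card_image_of_injOn]
  · simp [S]
  · rintro ⟨j, k⟩ h ⟨j', k'⟩ h' heq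
    simp only [S, Finset.coe_filter, Finset.mem_product, Finset.mem_Icc, Set.mem_ofPred_eq] at h h'
    have hk : k = k' := by
      have := (gap_strictMono P c).injective heq
      simp only at this
      omega
    subst hk
    have h1 := h.2.2
    have h2 := h'.2.2
    unfold hookNum at h1 h2
    have : j = j' := by
      rcases le_total j j' with hle | hle
      · have := rowLen_anti P h.1.1.1 hle
        omega
      · have := rowLen_anti P h'.1.1.1 hle
        omega
    subst this
    rfl

end Split

lemma Nhook_one {n : ℕ} (P : n.Partition) : Nhook 1 P = P.parts.toFinset.card := by
  unfold Nhook
  symm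
  have hcol : ∀ k, k ∈ P.parts → colLen P (k + 1) < colLen P k := fun k hk => by
    have h1 := count_parts_add P k
    have h2 : 0 < P.parts.count k := Multiset.count_pos.2 hk
    omega
  refine Finset.card_bij (fun k _ => (colLen P k, k)) ?_ ?_ ?_
  · intro k hk
    rw [Multiset.mem_toFinset] at hk
    have hk1 : 1 ≤ k := P.parts_pos hk
    have hk2 : k ≤ n := P.le_of_mem_parts hk
    have h := hcol k hk
    have hj : 1 ≤ colLen P k := by omega
    have h3 := (le_rowLen_iff P hj hk1).2 le_rfl
    have h4 := (le_rowLen_iff P hj (k := k + 1) (by omega)).not.2 (by omega)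
    simp only [Finset.mem_filter, Finset.mem_product, Finset.mem_Icc]
    refine ⟨⟨⟨hj, colLen_le P k⟩, hk1, hk2⟩, h3, ?_⟩
    unfold hookNum
    push_cast
    omega
  · intro a _ b _ h
    exact congrArg Prod.snd h
  · rintro ⟨j, k⟩ h
    simp only [Finset.mem_filter, Finset.mem_product, Finset.mem_Icc] at h
    obtain ⟨⟨⟨hj, _⟩, hk, _⟩, hle, hh⟩ := h
    unfold hookNum at hh
    have h1 := (le_rowLen_iff P hj hk).1 hle
    have h4 := (le_rowLen_iff P hj (k := k + 1) (by omega)).not.1 (by push_cast at hh; omega)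
    have h2 := count_parts_add P k
    refine ⟨k, ?_, ?_⟩
    · rw [Multiset.mem_toFinset, ← Multiset.count_pos]
      push_cast at hh
      omega
    · simp only [Prod.mk.injEq, and_true]
      push_cast at hh
      omega

/-- The type of all integer partitions. -/
abbrev AllPartitions : Type := Σ n, Nat.Partition n

section GenFun

open PowerSeries PowerSeries.WithPiTopology

variable {𝕜 : Type*} [RCLike 𝕜]

/-- The power series `1 + T (X^(k+1) + X^(2(k+1)) + ⋯)`. -/
noncomputable def partFactor (T : 𝕜) (k : ℕ) : PowerSeries 𝕜 :=
  PowerSeries.mk fun n => if n = 0 then 1 else if (k + 1) ∣ n then T else 0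

lemma one_add_tsum_eq_partFactor (T : 𝕜) (k : ℕ) :
    (1 + ∑' j : ℕ, T • (X : PowerSeries 𝕜) ^ ((k + 1) * (j + 1))) = partFactor T k := by
  have h : HasSum (fun j : ℕ => T • (X : PowerSeries 𝕜) ^ ((k + 1) * (j + 1)))
      (partFactor T k - 1) := by
    rw [HasSum, tendsto_iff_coeff_tendsto]
    intro d
    simp only [map_sum, coeff_smul, coeff_X_pow, smul_eq_mul, mul_ite, mul_one, mul_zero, map_sub,
      partFactor, coeff_mk, coeff_one]
    change HasSum (fun j : ℕ => if d = (k + 1) * (j + 1) then T else 0) _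
    by_cases hd : d = 0
    · subst hd
      have : ∀ j : ℕ, (if 0 = (k + 1) * (j + 1) then T else 0) = 0 := fun j =>
        if_neg (by positivity)
      simp only [this]
      simp
    · simp only [if_neg hd, sub_zero]
      by_cases hk : (k + 1) ∣ d
      · obtain ⟨m, rfl⟩ := hk
        have hm : m ≠ 0 := by rintro rfl; simp at hd
        rw [if_pos (dvd_mul_right _ _)]
        convert hasSum_ite_eq (m - 1) T using 3 with j
        simp only [Nat.mul_right_inj (Nat.succ_ne_zero k)]
        omega
      · rw [if_neg hk]
        have : ∀ j : ℕ, (if d = (k + 1) * (j + 1) then T else 0) = 0 := fun j =>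
          if_neg (by rintro rfl; exact hk (dvd_mul_right _ _))
        simp only [this]
        exact hasSum_zero
  rw [h.tsum_eq]
  ring

lemma tendsto_coeff_prod_partFactor (T : 𝕜) (n : ℕ) :
    Tendsto (fun K => coeff n (∏ k ∈ Finset.range K, partFactor T k)) atTop
      (nhds (∑ P : n.Partition, T ^ Nhook 1 P)) := by
  have h := (Nat.Partition.hasProd_genFun (fun _ _ => T)).tendsto_prod_nat
  simp only [one_add_tsum_eq_partFactor] at h
  have := (tendsto_iff_coeff_tendsto 𝕜 _ _ _).1 h n
  rw [Nat.Partition.coeff_genFun] at this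
  convert this using 3 with P
  rw [Nhook_one, Finsupp.prod, Finset.prod_const, Multiset.toFinsupp_support]

lemma hasSum_coeff_partFactor (T x : 𝕜) (hx : ‖x‖ < 1) (k : ℕ) :
    (Summable fun n => ‖coeff n (partFactor T k) * x ^ n‖) ∧
      ∑' n, coeff n (partFactor T k) * x ^ n = 1 + T * (x ^ (k + 1) / (1 - x ^ (k + 1))) := by
  constructor
  · refine Summable.of_nonneg_of_le (fun _ => norm_nonneg _) (fun n => ?_)
      ((summable_geometric_of_lt_one (norm_nonneg x) hx).mul_left (1 + ‖T‖))
    rw [norm_mul, norm_pow]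
    refine mul_le_mul_of_nonneg_right ?_ (by positivity)
    rw [partFactor, coeff_mk]
    split_ifs
    · simp
    · simp
    · simp; positivity
  · have hxk : ‖x ^ (k + 1)‖ < 1 := by
      rw [norm_pow]
      exact pow_lt_one₀ (norm_nonneg _) hx (by omega)
    have h1 : HasSum (fun j : ℕ => T * (x ^ (k + 1)) ^ j * x ^ (k + 1))
        (T * (1 - x ^ (k + 1))⁻¹ * x ^ (k + 1)) :=
      ((hasSum_geometric_of_norm_lt_one hxk).mul_left T).mul_right _
    have hinj : Function.Injective (fun j : ℕ => (k + 1) * (j + 1)) := fun a b h => by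
      have := Nat.eq_of_mul_eq_mul_left (Nat.succ_pos k) h
      omega
    have h2 : HasSum (fun n => (if n = 0 then 0 else if (k + 1) ∣ n then T else 0) * x ^ n)
        (T * (1 - x ^ (k + 1))⁻¹ * x ^ (k + 1)) := by
      rw [← hinj.hasSum_iff]
      · convert h1 using 2 with j
        simp only [Function.comp]
        rw [if_neg (by positivity), if_pos (dvd_mul_right _ _)]
        ring
      · intro n hn
        by_cases h0 : n = 0
        · simp [h0]
        · rw [if_neg h0, if_neg, zero_mul]
          rintro ⟨m, rfl⟩
          refine hn ⟨m - 1, ?_⟩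
          have hm : m ≠ 0 := by rintro rfl; simp at h0
          simp only
          rw [Nat.sub_add_cancel (Nat.one_le_iff_ne_zero.2 hm)]
    have h3 := (hasSum_ite_eq (0 : ℕ) (1 : 𝕜)).add h2
    have : (fun n => (if n = 0 then (1 : 𝕜) else 0)
        + (if n = 0 then 0 else if (k + 1) ∣ n then T else 0) * x ^ n)
        = fun n => coeff n (partFactor T k) * x ^ n := by
      funext n
      rw [partFactor, coeff_mk]
      by_cases h0 : n = 0
      · simp [h0]
      · simp [h0]
    rw [this] at h3
    rw [h3.tsum_eq]
    ring

lemma hasSum_coeff_prod_partFactor (T x : 𝕜) (hx : ‖x‖ < 1) (K : ℕ) :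
    (Summable fun n => ‖coeff n (∏ k ∈ Finset.range K, partFactor T k) * x ^ n‖) ∧
      ∑' n, coeff n (∏ k ∈ Finset.range K, partFactor T k) * x ^ n
        = ∏ k ∈ Finset.range K, (1 + T * (x ^ (k + 1) / (1 - x ^ (k + 1)))) := by
  induction K with
  | zero =>
    have : (fun n => coeff n (1 : PowerSeries 𝕜) * x ^ n) = fun n => if n = 0 then 1 else 0 := by
      funext n
      rw [coeff_one]
      by_cases h : n = 0 <;> simp [h]
    have h2 : (fun n => ‖coeff n (1 : PowerSeries 𝕜) * x ^ n‖)
        = fun n => if n = 0 then 1 else 0 := by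
      funext n
      rw [congrFun this n]
      by_cases h : n = 0 <;> simp [h]
    simp only [Finset.range_zero, Finset.prod_empty]
    rw [this, h2]
    exact ⟨(hasSum_ite_eq 0 1).summable, tsum_ite_eq 0 _⟩
  | succ K ih =>
    obtain ⟨h1, h2⟩ := hasSum_coeff_partFactor T x hx K
    have key : ∀ n, coeff n (∏ k ∈ Finset.range (K + 1), partFactor T k) * x ^ n
        = ∑ kl ∈ Finset.HasAntidiagonal.antidiagonal n,
          (coeff kl.1 (∏ k ∈ Finset.range K, partFactor T k) * x ^ kl.1)
            * (coeff kl.2 (partFactor T K) * x ^ kl.2) := by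
      intro n
      rw [Finset.prod_range_succ, coeff_mul, Finset.sum_mul]
      refine Finset.sum_congr rfl fun kl hkl => ?_
      rw [← Finset.HasAntidiagonal.mem_antidiagonal.1 hkl, pow_add]
      ring
    have hs := summable_norm_sum_mul_antidiagonal_of_summable_norm ih.1 h1
    have ht := tsum_mul_tsum_eq_tsum_sum_antidiagonal_of_summable_norm ih.1 h1
    simp only [← key] at hs ht
    exact ⟨hs, by rw [← ht, ih.2, h2, Finset.prod_range_succ]⟩

lemma coeff_partFactor_one_nonneg (k n : ℕ) : 0 ≤ coeff n (partFactor (1 : ℝ) k) := by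
  rw [partFactor, coeff_mk]
  split_ifs <;> simp

lemma coeff_prod_partFactor_one_nonneg (K n : ℕ) :
    0 ≤ coeff n (∏ k ∈ Finset.range K, partFactor (1 : ℝ) k) := by
  induction K generalizing n with
  | zero =>
    rw [Finset.range_zero, Finset.prod_empty, coeff_one]
    split_ifs <;> simp
  | succ K ih =>
    rw [Finset.prod_range_succ, coeff_mul]
    exact Finset.sum_nonneg fun kl _ => mul_nonneg (ih _) (coeff_partFactor_one_nonneg _ _)

lemma coeff_prod_partFactor_one_le (K n : ℕ) :
    coeff n (∏ k ∈ Finset.range K, partFactor (1 : ℝ) k) ≤ Fintype.card n.Partition := by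
  have h := tendsto_coeff_prod_partFactor (1 : ℝ) n
  simp only [one_pow, Finset.sum_const, Finset.card_univ, nsmul_eq_mul, mul_one] at h
  refine Monotone.ge_of_tendsto (monotone_nat_of_le_succ fun K => ?_) h K
  rw [Finset.prod_range_succ, coeff_mul]
  have hmem : (n, 0) ∈ Finset.HasAntidiagonal.antidiagonal n := by simp
  refine le_trans ?_ (Finset.single_le_sum (fun kl _ => mul_nonneg
    (coeff_prod_partFactor_one_nonneg K _) (coeff_partFactor_one_nonneg _ _)) hmem)
  simp [partFactor]

lemma norm_coeff_prod_partFactor_le (T : 𝕜) (hT : ‖T‖ ≤ 1) (K n : ℕ) :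
    ‖coeff n (∏ k ∈ Finset.range K, partFactor T k)‖
      ≤ coeff n (∏ k ∈ Finset.range K, partFactor (1 : ℝ) k) := by
  induction K generalizing n with
  | zero =>
    simp only [Finset.range_zero, Finset.prod_empty, coeff_one]
    split_ifs <;> simp
  | succ K ih =>
    rw [Finset.prod_range_succ, Finset.prod_range_succ, coeff_mul, coeff_mul]
    refine (norm_sum_le _ _).trans (Finset.sum_le_sum fun kl _ => ?_)
    rw [norm_mul]
    refine mul_le_mul (ih _) ?_ (norm_nonneg _) (coeff_prod_partFactor_one_nonneg _ _)
    simp only [partFactor, coeff_mk]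
    split_ifs <;> simp [hT]

lemma summable_card_mul_pow {r : ℝ} (h0 : 0 ≤ r) (h1 : r < 1) :
    Summable fun n => (Fintype.card (Nat.Partition n) : ℝ) * r ^ n := by
  refine summable_of_sum_range_le (c := Real.exp (r / (1 - r) * (1 - r)⁻¹))
    (fun n => by positivity) fun N => ?_
  have hlim : Tendsto (fun K => ∑ n ∈ Finset.range N,
      coeff n (∏ k ∈ Finset.range K, partFactor (1 : ℝ) k) * r ^ n) atTop
      (nhds (∑ n ∈ Finset.range N, (Fintype.card (Nat.Partition n) : ℝ) * r ^ n)) := by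
    refine tendsto_finsetSum _ fun n _ => Tendsto.mul_const _ ?_
    have h := tendsto_coeff_prod_partFactor (1 : ℝ) n
    simpa only [one_pow, Finset.sum_const, Finset.card_univ, nsmul_eq_mul, mul_one] using h
  refine le_of_tendsto' hlim fun K => ?_
  obtain ⟨hs, ht⟩ := hasSum_coeff_prod_partFactor (1 : ℝ) r
    (by rwa [Real.norm_eq_abs, abs_of_nonneg h0]) K
  refine (Summable.sum_le_tsum _ (fun n _ => mul_nonneg (coeff_prod_partFactor_one_nonneg K n)
    (by positivity)) hs.of_norm).trans ?_
  rw [ht]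
  have h1r : 0 < 1 - r := by linarith
  have hgeo := summable_geometric_of_lt_one h0 h1
  calc ∏ k ∈ Finset.range K, (1 + 1 * (r ^ (k + 1) / (1 - r ^ (k + 1))))
      ≤ ∏ k ∈ Finset.range K, Real.exp (r / (1 - r) * r ^ k) := by
        refine Finset.prod_le_prod (fun k _ => ?_) fun k _ => ?_
        · have : r ^ (k + 1) < 1 := pow_lt_one₀ h0 h1 (by omega)
          have : 0 < 1 - r ^ (k + 1) := by linarith
          positivity
        · have hle : r ^ (k + 1) ≤ r := pow_le_of_le_one h0 h1.le (by omega)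
          have : r ^ (k + 1) / (1 - r ^ (k + 1)) ≤ r / (1 - r) * r ^ k := by
            rw [div_mul_eq_mul_div, ← pow_succ']
            exact div_le_div_of_nonneg_left (by positivity) h1r (by linarith)
          have h2 := Real.add_one_le_exp (r / (1 - r) * r ^ k)
          linarith
    _ = Real.exp (∑ k ∈ Finset.range K, r / (1 - r) * r ^ k) := (Real.exp_sum _ _).symm
    _ ≤ _ := by
      rw [Real.exp_le_exp, ← Finset.mul_sum, ← tsum_geometric_of_lt_one h0 h1]
      exact mul_le_mul_of_nonneg_left (hgeo.sum_le_tsum _ fun n _ => by positivity)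
        (by positivity)

lemma summable_pow_size {r : ℝ} (h0 : 0 ≤ r) (h1 : r < 1) :
    Summable fun x : AllPartitions => r ^ x.1 := by
  rw [summable_sigma_of_nonneg fun x => by positivity]
  refine ⟨fun n => (hasSum_fintype _).summable, ?_⟩
  simpa [tsum_fintype] using summable_card_mul_pow h0 h1

end GenFun

/-- The generating function of all partitions by size and number of hooks of length `t`. -/
noncomputable def hookGF (t : ℕ) (T q : ℂ) : ℂ := ∑' x : AllPartitions, T ^ Nhook t x.2 * q ^ x.1

lemma summable_hookGF (t : ℕ) {T q : ℂ} (hT : ‖T‖ ≤ 1) (hq : ‖q‖ < 1) :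
    Summable fun x : AllPartitions => ‖T ^ Nhook t x.2 * q ^ x.1‖ := by
  refine Summable.of_nonneg_of_le (fun _ => norm_nonneg _) (fun x => ?_)
    (summable_pow_size (norm_nonneg q) hq)
  rw [norm_mul, norm_pow, norm_pow]
  exact mul_le_of_le_one_left (by positivity) (pow_le_one₀ (norm_nonneg _) hT)

lemma hasSum_hookGF (t : ℕ) {T q : ℂ} (hT : ‖T‖ ≤ 1) (hq : ‖q‖ < 1) :
    HasSum (fun n => (∑ P : n.Partition, T ^ Nhook t P) * q ^ n) (hookGF t T q) := by
  have h := (summable_hookGF t hT hq).of_norm.hasSum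
  have := h.sigma (g := fun n => (∑ P : n.Partition, T ^ Nhook t P) * q ^ n) fun n => by
    rw [Finset.sum_mul]
    exact hasSum_fintype _
  exact this

lemma tendsto_prod_hookGF_one {T q : ℂ} (hT : ‖T‖ ≤ 1) (hq : ‖q‖ < 1) :
    Tendsto (fun K => ∏ k ∈ Finset.range K, (1 + T * (q ^ (k + 1) / (1 - q ^ (k + 1))))) atTop
      (nhds (hookGF 1 T q)) := by
  have h := tendsto_tsum_of_dominated_convergence (𝓕 := atTop)
    (f := fun K n => PowerSeries.coeff n (∏ k ∈ Finset.range K, partFactor T k) * q ^ n)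
    (g := fun n => (∑ P : n.Partition, T ^ Nhook 1 P) * q ^ n)
    (bound := fun n => (Fintype.card (Nat.Partition n) : ℝ) * ‖q‖ ^ n)
    (summable_card_mul_pow (norm_nonneg q) hq)
    (fun n => (tendsto_coeff_prod_partFactor T n).mul_const _)
    (Eventually.of_forall fun K n => by
      rw [norm_mul, norm_pow]
      exact mul_le_mul_of_nonneg_right ((norm_coeff_prod_partFactor_le T hT K n).trans
        (coeff_prod_partFactor_one_le K n)) (by positivity))
  rw [(hasSum_hookGF 1 hT hq).tsum_eq] at h
  simpa only [(hasSum_coeff_prod_partFactor T q hq _).2] using h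

section Quotient

variable (t : ℕ) [NeZero t]

/-- The charged partition corresponds to the family of charged partitions on its residue classes. -/
noncomputable def chargedQuotient : AllPartitions × ℤ ≃ (Fin t → AllPartitions × ℤ) :=
  encodeEquiv.trans ((split t).trans (Equiv.piCongrRight fun _ => encodeEquiv.symm))

lemma encode_chargedQuotient (x : AllPartitions × ℤ) (r : Fin t) :
    encode (chargedQuotient t x r) = split t (encode x) r :=
  encodeEquiv.apply_symm_apply (split t (encode x) r)

lemma chargedQuotient_charge (x : AllPartitions × ℤ) :
    x.2 = ∑ r, (chargedQuotient t x r).2 := by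
  rw [← moment_encode_one x, moment_split t]
  refine Finset.sum_congr rfl fun r _ => ?_
  rw [← moment_encode_one (chargedQuotient t x r), encode_chargedQuotient]

lemma chargedQuotient_size (x : AllPartitions × ℤ) :
    2 * (x.1.1 : ℤ) + x.2 * (x.2 - 1) = ∑ r : Fin t, (t * (2 * ((chargedQuotient t x r).1.1 : ℤ)
      + (chargedQuotient t x r).2 * ((chargedQuotient t x r).2 - 1))
      + 2 * ((r : ℕ) * (chargedQuotient t x r).2)) := by
  rw [← two_mul_moment_encode_id x, moment_split t, Finset.mul_sum]
  refine Finset.sum_congr rfl fun r _ => ?_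
  rw [← encode_chargedQuotient, ← two_mul_moment_encode_id (chargedQuotient t x r)]
  have h1 : (fun j : ℤ => j * t + ((r : ℕ) : ℤ)) = fun j => (t : ℤ) * j + ((r : ℕ) : ℤ) * 1 := by
    funext j; ring
  rw [h1, moment_add, moment_const_mul, moment_const_mul _ _ (fun _ => 1), moment_encode_one]
  ring

lemma chargedQuotient_hook (x : AllPartitions × ℤ) :
    Nhook t x.1.2 = ∑ r, Nhook 1 (chargedQuotient t x r).1.2 := by
  have h := hookCount_encode x t NeZero.one_le
  rw [hookCount_split] at h
  have h2 : ∀ r, hookCount 1 (split t (encode x) r)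
      = Nhook 1 (chargedQuotient t x r).1.2 := fun r => by
    rw [← encode_chargedQuotient, hookCount_encode _ 1 le_rfl]
  simp only [h2] at h
  exact_mod_cast h.symm

/-- The core-quotient bijection. -/
noncomputable def coreQuotient :
    AllPartitions ≃ {c : Fin t → ℤ // ∑ r, c r = 0} × (Fin t → AllPartitions) where
  toFun P := (⟨fun r => (chargedQuotient t (P, 0) r).2, (chargedQuotient_charge t (P, 0)).symm⟩,
    fun r => (chargedQuotient t (P, 0) r).1)
  invFun z := ((chargedQuotient t).symm fun r => (z.2 r, z.1.1 r)).1
  left_inv P := by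
    change ((chargedQuotient t).symm (chargedQuotient t (P, 0))).1 = P
    rw [Equiv.symm_apply_apply]
  right_inv z := by
    obtain ⟨⟨c, hc⟩, Q⟩ := z
    have h := chargedQuotient_charge t ((chargedQuotient t).symm fun r => (Q r, c r))
    rw [Equiv.apply_symm_apply] at h
    have h2 : (((chargedQuotient t).symm fun r => (Q r, c r)).1, (0 : ℤ))
        = (chargedQuotient t).symm fun r => (Q r, c r) := by
      refine Prod.ext rfl ?_
      rw [h]
      exact hc.symm
    simp only [h2, Equiv.apply_symm_apply]

/-- The size of the core with the given charges. -/
noncomputable def coreSize (c : {c : Fin t → ℤ // ∑ r, c r = 0}) : ℕ :=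
  ((coreQuotient t).symm (c, fun _ => ⟨0, default⟩)).1

lemma coreQuotient_symm_size (c : {c : Fin t → ℤ // ∑ r, c r = 0}) (Q : Fin t → AllPartitions) :
    ((coreQuotient t).symm (c, Q)).1 = coreSize t c + t * ∑ r, (Q r).1 := by
  have key : ∀ Q : Fin t → AllPartitions, 2 * (((coreQuotient t).symm (c, Q)).1 : ℤ)
      = ∑ r : Fin t, (t * (2 * ((Q r).1 : ℤ) + c.1 r * (c.1 r - 1)) + 2 * ((r : ℕ) * c.1 r)) := by
    intro Q
    have h := chargedQuotient_size t ((chargedQuotient t).symm fun r => (Q r, c.1 r))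
    have h1 := chargedQuotient_charge t ((chargedQuotient t).symm fun r => (Q r, c.1 r))
    rw [Equiv.apply_symm_apply] at h h1
    rw [h1, c.2, zero_mul, add_zero] at h
    exact h
  have h1 := key Q
  have h2 := key fun _ => ⟨0, default⟩
  change 2 * (coreSize t c : ℤ) = _ at h2
  have h3 : ∑ r : Fin t, (t * (2 * ((Q r).1 : ℤ) + c.1 r * (c.1 r - 1)) + 2 * ((r : ℕ) * c.1 r))
      = 2 * (coreSize t c : ℤ) + 2 * (t * ∑ r, ((Q r).1 : ℤ)) := by
    rw [h2, Finset.mul_sum, Finset.mul_sum, ← Finset.sum_add_distrib]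
    refine Finset.sum_congr rfl fun r _ => ?_
    push_cast
    ring
  rw [h3] at h1
  have : (((coreQuotient t).symm (c, Q)).1 : ℤ) = coreSize t c + t * ∑ r, ((Q r).1 : ℤ) := by
    linarith
  exact_mod_cast this

lemma coreQuotient_symm_hook (c : {c : Fin t → ℤ // ∑ r, c r = 0}) (Q : Fin t → AllPartitions) :
    Nhook t ((coreQuotient t).symm (c, Q)).2 = ∑ r, Nhook 1 (Q r).2 := by
  have h := chargedQuotient_hook t ((chargedQuotient t).symm fun r => (Q r, c.1 r))
  rw [Equiv.apply_symm_apply] at h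
  exact h

end Quotient

lemma tsum_fin_prod {α : Type*} (f : α → ℂ) (hf : Summable fun a => ‖f a‖) (n : ℕ) :
    (Summable fun Q : Fin n → α => ‖∏ r, f (Q r)‖) ∧
      ∑' Q : Fin n → α, ∏ r, f (Q r) = (∑' a, f a) ^ n := by
  induction n with
  | zero => exact ⟨(hasSum_fintype _).summable, by simp⟩
  | succ n ih =>
    let e : α × (Fin n → α) ≃ (Fin (n + 1) → α) := Fin.consEquiv fun _ => α
    have he : ∀ x : α × (Fin n → α), ∏ r, f (e x r) = f x.1 * ∏ r, f (x.2 r) := fun x => by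
      rw [Fin.prod_univ_succ]
      rfl
    constructor
    · rw [← e.summable_iff]
      have h := Summable.mul_norm (f := f) (g := fun Q : Fin n → α => ∏ r, f (Q r)) hf ih.1
      simp only [← he] at h
      exact h
    · rw [← e.tsum_eq]
      have h := tsum_mul_tsum_of_summable_norm (f := f) (g := fun Q : Fin n → α => ∏ r, f (Q r))
        hf ih.1
      simp only [← he] at h
      rw [← h, ih.2, pow_succ']

lemma exists_hookGF_eq (t : ℕ) (ht : 1 ≤ t) (q : ℂ) (hq : ‖q‖ < 1) :
    ∃ C : ℂ, ∀ T : ℂ, ‖T‖ ≤ 1 → hookGF t T q = C * hookGF 1 T (q ^ t) ^ t := by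
  have : NeZero t := ⟨by omega⟩
  refine ⟨∑' c, q ^ coreSize t c, fun T hT => ?_⟩
  have hqt : ‖q ^ t‖ < 1 := by
    rw [norm_pow]
    exact pow_lt_one₀ (norm_nonneg _) hq (by omega)
  have hc : Summable fun c => ‖q ^ coreSize t c‖ := by
    have h := summable_pow_size (norm_nonneg q) hq
    have hinj : Function.Injective fun c : {c : Fin t → ℤ // ∑ r, c r = 0} =>
        (coreQuotient t).symm (c, fun _ => ⟨0, default⟩) := fun a b h =>
      congrArg Prod.fst ((coreQuotient t).symm.injective h)
    simp only [norm_pow]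
    exact h.comp_injective hinj
  obtain ⟨h1, h2⟩ := tsum_fin_prod _ (summable_hookGF 1 hT hqt) t
  unfold hookGF
  rw [← h2, tsum_mul_tsum_of_summable_norm hc h1, ← (coreQuotient t).symm.tsum_eq]
  refine tsum_congr fun x => ?_
  obtain ⟨c, Q⟩ := x
  rw [coreQuotient_symm_hook, coreQuotient_symm_size, Finset.prod_mul_distrib,
    Finset.prod_pow_eq_pow_sum, Finset.prod_pow_eq_pow_sum, pow_add, pow_mul]
  ring

/-- The geometric series `e^{-w} + e^{-2w} + ⋯`. -/
noncomputable def bose (w : ℂ) : ℂ := (exp w - 1)⁻¹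

lemma norm_exp_neg_lt_one {w : ℂ} (hw : 0 < w.re) : ‖exp (-w)‖ < 1 := by
  rw [norm_exp, neg_re, Real.exp_lt_one_iff]
  linarith

lemma exp_neg_succ_mul (w : ℂ) (k : ℕ) : exp (-((k + 1) * w)) = exp (-w) ^ (k + 1) := by
  rw [← exp_nat_mul]
  push_cast
  ring_nf

lemma hasSum_bose {w : ℂ} (hw : 0 < w.re) :
    HasSum (fun k : ℕ => exp (-((k + 1) * w))) (bose w) := by
  have h := (hasSum_geometric_of_norm_lt_one (norm_exp_neg_lt_one hw)).mul_left (exp (-w))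
  have h1 : exp (-w) * (1 - exp (-w))⁻¹ = bose w := by
    rw [bose, exp_neg]
    have h0 := exp_ne_zero w
    rw [← mul_inv, mul_sub, mul_one, mul_inv_cancel₀ h0]
  rw [h1] at h
  have h2 : (fun k : ℕ => exp (-((k + 1) * w))) = fun k => exp (-w) * exp (-w) ^ k := by
    funext k
    rw [exp_neg_succ_mul, pow_succ']
  rw [h2]
  exact h

lemma succ_mul_re (m : ℕ) (w : ℂ) : (((m : ℂ) + 1) * w).re = (m + 1) * w.re := by simp

lemma summable_norm_bose {w : ℂ} (hw : 0 < w.re) :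
    Summable (fun k : ℕ => ‖exp (-((k + 1) * w))‖) := by
  have h := (summable_geometric_of_lt_one (norm_nonneg _)
    (norm_exp_neg_lt_one hw)).mul_right ‖exp (-w)‖
  refine h.congr fun k => ?_
  rw [exp_neg_succ_mul, pow_succ, norm_mul, norm_pow]

lemma exists_hasSum_of_summable_prod {f : ℕ → ℕ → ℂ} (hf : Summable fun p : ℕ × ℕ => f p.1 p.2)
    {a b : ℕ → ℂ} (ha : ∀ k, HasSum (f k) (a k)) (hb : ∀ m, HasSum (fun k => f k m) (b m)) :
    ∃ S, HasSum a S ∧ HasSum b S := by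
  obtain ⟨S, hS⟩ := hf
  have hswap : HasSum (fun p : ℕ × ℕ => f p.2 p.1) S :=
    (Equiv.prodComm ℕ ℕ).hasSum_iff (f := fun p : ℕ × ℕ => f p.1 p.2) |>.2 hS
  exact ⟨S, hS.prod_fiberwise ha, hswap.prod_fiberwise hb⟩

/-- The logarithm of the generating function of partitions at `q = e^{-w}`. -/
noncomputable def logPart (w : ℂ) : ℂ := ∑' m : ℕ, bose ((m + 1) * w) / (m + 1)

lemma hasSum_logPart {w : ℂ} (hw : 0 < w.re) :
    HasSum (fun m : ℕ => bose ((m + 1) * w) / (m + 1)) (logPart w) ∧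
      HasSum (fun k : ℕ => -log (1 - exp (-((k + 1) * w)))) (logPart w) := by
  have hr := norm_exp_neg_lt_one hw
  have hsum : Summable fun p : ℕ × ℕ =>
      exp (-((p.1 + 1) * ((p.2 + 1) * w))) / ((p.2 : ℂ) + 1) := by
    refine Summable.of_norm_bounded ((summable_geometric_of_lt_one (norm_nonneg _) hr).mul_of_nonneg
      (summable_geometric_of_lt_one (norm_nonneg _) hr) (fun k => by positivity)
      fun k => by positivity) fun p => ?_
    have h1 : exp (-((p.1 + 1) * ((p.2 + 1) * w))) = exp (-w) ^ ((p.1 + 1) * (p.2 + 1)) := by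
      rw [exp_neg_succ_mul, exp_neg_succ_mul, ← pow_mul, mul_comm]
    rw [h1, norm_div, norm_pow, ← pow_add]
    have h2 : (1 : ℝ) ≤ ‖((p.2 : ℂ) + 1)‖ := by
      rw [← Nat.cast_succ, norm_natCast]
      exact_mod_cast Nat.succ_pos _
    refine (div_le_self (by positivity) h2).trans ?_
    exact pow_le_pow_of_le_one (norm_nonneg _) hr.le (by nlinarith [Nat.zero_le (p.1 * p.2)])
  have hb : ∀ m : ℕ, HasSum (fun k : ℕ => exp (-((k + 1) * ((m + 1) * w))) / ((m : ℂ) + 1))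
      (bose ((m + 1) * w) / (m + 1)) := fun m =>
    (hasSum_bose (w := (m + 1) * w) (by rw [succ_mul_re]; positivity)).div_const _
  have ha : ∀ k : ℕ, HasSum (fun m : ℕ => exp (-((k + 1) * ((m + 1) * w))) / ((m : ℂ) + 1))
      (-log (1 - exp (-((k + 1) * w)))) := fun k => by
    have hk : ‖exp (-((k + 1) * w))‖ < 1 := by
      rw [exp_neg_succ_mul, norm_pow]
      exact pow_lt_one₀ (norm_nonneg _) hr (by omega)
    have h := hasSum_taylorSeries_neg_log' hk
    have h2 : (fun m : ℕ => exp (-((k + 1) * ((m + 1) * w))) / ((m : ℂ) + 1))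
        = fun m : ℕ => exp (-((k + 1) * w)) ^ (m + 1) / ((m : ℂ) + 1) := by
      funext m
      rw [← exp_neg_succ_mul]
      ring_nf
    rw [h2]
    exact h
  obtain ⟨S, h1, h2⟩ := exists_hasSum_of_summable_prod hsum ha hb
  have h3 : logPart w = S := h2.tsum_eq
  rw [h3]
  exact ⟨h2, h1⟩

/-- The logarithm of `∏ (1 + z q^k)` at `q = e^{-w}`. -/
noncomputable def logTwist (z w : ℂ) : ℂ := ∑' k : ℕ, log (1 + z * exp (-((k + 1) * w)))

lemma norm_mul_exp_le {z w : ℂ} (hz : ‖z‖ ≤ 1 / 2) (hw : 0 < w.re) (k : ℕ) :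
    ‖z * exp (-((k + 1) * w))‖ ≤ 1 / 2 := by
  rw [norm_mul, exp_neg_succ_mul, norm_pow]
  exact (mul_le_of_le_one_right (norm_nonneg _)
    (pow_le_one₀ (norm_nonneg _) (norm_exp_neg_lt_one hw).le)).trans hz

lemma hasSum_logTwist {z w : ℂ} (hz : ‖z‖ ≤ 1 / 2) (hw : 0 < w.re) :
    HasSum (fun k : ℕ => log (1 + z * exp (-((k + 1) * w)))) (logTwist z w) := by
  refine Summable.hasSum (Summable.of_norm_bounded
    ((summable_norm_bose hw).mul_left (3 / 2 * ‖z‖)) fun k => ?_)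
  refine (norm_log_one_add_half_le_self (norm_mul_exp_le hz hw k)).trans ?_
  rw [norm_mul]
  linarith

lemma hookGF_one_exp {z w : ℂ} (hz : ‖z‖ ≤ 1 / 2) (hz1 : ‖1 + z‖ ≤ 1) (hw : 0 < w.re) :
    hookGF 1 (1 + z) (exp (-w)) = exp (logPart w + logTwist z w) := by
  have h := tendsto_prod_hookGF_one hz1 (norm_exp_neg_lt_one hw)
  have h2 := ((hasSum_logPart hw).2.add (hasSum_logTwist hz hw)).tendsto_sum_nat.cexp
  refine tendsto_nhds_unique h (h2.congr fun K => ?_)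
  rw [exp_sum]
  refine Finset.prod_congr rfl fun k _ => ?_
  have hk : ‖exp (-((k + 1) * w))‖ < 1 := by
    rw [exp_neg_succ_mul, norm_pow]
    exact pow_lt_one₀ (norm_nonneg _) (norm_exp_neg_lt_one hw) (by omega)
  rw [← exp_neg_succ_mul]
  set x := exp (-((k + 1) * w)) with hx
  have hx1 : 1 - x ≠ 0 := fun h0 => by
    rw [← sub_eq_zero.1 h0] at hk
    simp at hk
  have hx2 : 1 + z * x ≠ 0 := fun h0 => by
    have h3 := norm_mul_exp_le hz hw k
    rw [← hx, show z * x = -1 by linear_combination h0] at h3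
    norm_num at h3
  rw [exp_add, exp_neg, exp_log hx1, exp_log hx2]
  field_simp
  ring

lemma hookGF_exp (t : ℕ) (ht : 1 ≤ t) {z w : ℂ} (hz : ‖z‖ ≤ 1 / 2) (hz1 : ‖1 + z‖ ≤ 1)
    (hw : 0 < w.re) :
    hookGF t (1 + z) (exp (-w)) = exp (logPart w + t * logTwist z (t * w)) := by
  obtain ⟨C, hC⟩ := exists_hookGF_eq t ht (exp (-w)) (norm_exp_neg_lt_one hw)
  have htw : 0 < ((t : ℂ) * w).re := by
    simp only [mul_re, natCast_re, natCast_im, zero_mul, sub_zero]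
    positivity
  have hpow : exp (-w) ^ t = exp (-(t * w)) := by
    rw [← exp_nat_mul]
    ring_nf
  have h0 : ∀ w : ℂ, logTwist 0 w = 0 := fun w => by simp [logTwist]
  have h1 := hC 1 (by simp)
  have h2 : hookGF t 1 (exp (-w)) = hookGF 1 1 (exp (-w)) := by simp [hookGF]
  have h3 := hookGF_one_exp (z := 0) (by simp) (by simp) hw
  have h4 := hookGF_one_exp (z := 0) (by simp) (by simp) htw
  rw [add_zero, h0, add_zero] at h3 h4
  rw [hpow, h2, h3, h4] at h1
  rw [hC _ hz1, hpow, hookGF_one_exp hz hz1 htw, exp_add, exp_add, mul_pow, ← mul_assoc, ← h1,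
    ← exp_nat_mul (logTwist z _)]

lemma norm_logTwist_sub_le {z w : ℂ} (hz : ‖z‖ ≤ 1 / 2) (hw : 0 < w.re) :
    ‖logTwist z w - (z * bose w - z ^ 2 / 2 * bose (2 * w))‖ ≤ ‖z‖ ^ 3 * (bose w.re).re := by
  have hw2 : 0 < (2 * w).re := by
    simp only [mul_re, re_ofNat, im_ofNat, zero_mul, sub_zero]
    positivity
  have h := (hasSum_logTwist hz hw).sub
    (((hasSum_bose hw).mul_left z).sub ((hasSum_bose hw2).mul_left (z ^ 2 / 2)))
  have hb := reCLM.hasSum (hasSum_bose (w := (w.re : ℂ)) (by simpa using hw))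
  have hb' := hb.mul_left (‖z‖ ^ 3)
  rw [← h.tsum_eq]
  refine tsum_of_norm_bounded hb' fun k => ?_
  have hk := norm_mul_exp_le hz hw k
  have h1 := norm_log_sub_logTaylor_le 2 (z := z * exp (-((k + 1) * w))) (by linarith)
  have h2 : logTaylor 3 (z * exp (-((k + 1) * w)))
      = z * exp (-((k + 1) * w)) - z ^ 2 / 2 * exp (-((k + 1) * (2 * w))) := by
    rw [show (-(((k : ℂ) + 1) * (2 * w))) = ((2 : ℕ) : ℂ) * (-((k + 1) * w)) by push_cast; ring,
      exp_nat_mul]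
    simp [logTaylor_succ, logTaylor_zero]
    ring
  rw [h2] at h1
  have h3 : ‖exp (-((k + 1) * w))‖ = Real.exp (-((k + 1) * w.re)) := by
    rw [norm_exp]
    congr 1
    simp
  have h4 : reCLM (exp (-((k + 1) * (w.re : ℂ)))) = Real.exp (-((k + 1) * w.re)) := by
    rw [reCLM_apply, ← exp_ofReal_re]
    push_cast
    rfl
  rw [norm_mul, h3] at hk h1
  rw [h4]
  refine h1.trans ?_
  set y := Real.exp (-((k + 1) * w.re))
  have hy1 : y ≤ 1 := by
    rw [Real.exp_le_one_iff]
    have : 0 < ((k : ℝ) + 1) * w.re := by positivity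
    linarith
  have hy0 : 0 < y := Real.exp_pos _
  have h5 : (1 - ‖z‖ * y)⁻¹ ≤ 2 := by
    rw [inv_le_comm₀ (by linarith) (by norm_num)]
    linarith
  have h6 : (‖z‖ * y) ^ 3 ≤ ‖z‖ ^ 3 * y := by
    rw [mul_pow]
    exact mul_le_mul_of_nonneg_left (pow_le_of_le_one hy0.le hy1 (by norm_num)) (by positivity)
  have h7 : (0 : ℝ) ≤ (‖z‖ * y) ^ 3 := by positivity
  norm_num
  nlinarith

lemma mul_exp_half_le {x : ℝ} (hx : 0 ≤ x) : x * Real.exp (x / 2) ≤ Real.exp x - 1 := by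
  have h := Real.self_le_sinh_iff.2 (show 0 ≤ x / 2 by positivity)
  rw [Real.sinh_eq, Real.exp_neg] at h
  have h1 : Real.exp x = Real.exp (x / 2) * Real.exp (x / 2) := by
    rw [← Real.exp_add]
    ring_nf
  have h0 := Real.exp_pos (x / 2)
  have h2 : x * Real.exp (x / 2) ≤ (Real.exp (x / 2) - (Real.exp (x / 2))⁻¹) * Real.exp (x / 2) :=
    mul_le_mul_of_nonneg_right (by linarith) h0.le
  rw [sub_mul, inv_mul_cancel₀ h0.ne', ← h1] at h2
  exact h2

lemma sq_mul_exp_le {x : ℝ} (hx : 0 ≤ x) : x ^ 2 * Real.exp x ≤ (Real.exp x - 1) ^ 2 := by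
  have h := pow_le_pow_left₀ (by positivity) (mul_exp_half_le hx) 2
  have h1 : Real.exp x = Real.exp (x / 2) ^ 2 := by
    rw [← Real.exp_nat_mul]
    congr 1
    push_cast
    ring
  rwa [mul_pow, ← h1] at h

lemma exp_re_sub_one_le_norm (z : ℂ) : Real.exp z.re - 1 ≤ ‖exp z - 1‖ := by
  have h := norm_sub_norm_le (exp z) 1
  rwa [norm_exp, norm_one] at h

lemma exp_sub_one_ne_zero {z : ℂ} (hz : 0 < z.re) : exp z - 1 ≠ 0 := by
  have h := exp_re_sub_one_le_norm z
  have h1 := Real.add_one_lt_exp hz.ne'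
  rw [← norm_pos_iff]
  linarith

lemma norm_exp_div_sq_le {z : ℂ} (hz : 0 < z.re) : ‖exp z / (exp z - 1) ^ 2‖ ≤ 1 / z.re ^ 2 := by
  have h1 := exp_re_sub_one_le_norm z
  have h2 : 0 < Real.exp z.re - 1 := by linarith [Real.add_one_lt_exp hz.ne']
  rw [norm_div, norm_pow, norm_exp]
  calc Real.exp z.re / ‖exp z - 1‖ ^ 2 ≤ Real.exp z.re / (Real.exp z.re - 1) ^ 2 := by gcongr
    _ ≤ 1 / z.re ^ 2 := by
      rw [div_le_div_iff₀ (by positivity) (by positivity)]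
      linarith [sq_mul_exp_le hz.le]

lemma norm_inv_sq_sub_le_of_norm_le_one {z : ℂ} (hz : 0 < z.re) (h1 : ‖z‖ ≤ 1) :
    ‖(z ^ 2)⁻¹ - exp z / (exp z - 1) ^ 2‖ ≤ 1 := by
  have hz0 : z ≠ 0 := fun h => by simp [h] at hz
  have hn0 : 0 < ‖z‖ := norm_pos_iff.2 hz0
  set E := exp z - 2 + exp (-z) - z ^ 2 with hE
  have hEn : ‖E‖ ≤ 5 / 48 * ‖z‖ ^ 4 := by
    have ha := exp_bound h1 (n := 4) (by norm_num)
    have hb := exp_bound (x := -z) (by rwa [norm_neg]) (n := 4) (by norm_num)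
    have heq : E = (exp z - ∑ m ∈ Finset.range 4, z ^ m / (m.factorial : ℂ))
        + (exp (-z) - ∑ m ∈ Finset.range 4, (-z) ^ m / (m.factorial : ℂ)) := by
      simp only [Finset.sum_range_succ, Finset.sum_range_zero, Nat.factorial, hE]
      push_cast
      ring
    rw [heq]
    refine (norm_add_le _ _).trans ?_
    rw [norm_neg] at hb
    norm_num [Nat.factorial] at ha hb ⊢
    linarith
  have hD : exp z / (exp z - 1) ^ 2 = (z ^ 2 + E)⁻¹ := by
    have h2 := exp_sub_one_ne_zero hz
    have h3 : z ^ 2 + E = (exp z - 1) ^ 2 / exp z := by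
      rw [hE, exp_neg]
      field_simp
      ring
    rw [h3, inv_div]
  have hlow : 43 / 48 * ‖z‖ ^ 2 ≤ ‖z ^ 2 + E‖ := by
    have h4 : ‖z‖ ^ 4 ≤ ‖z‖ ^ 2 := pow_le_pow_of_le_one hn0.le h1 (by norm_num)
    have h5 := norm_sub_norm_le (z ^ 2) (-E)
    rw [sub_neg_eq_add, norm_neg, norm_pow] at h5
    linarith
  have hne : z ^ 2 + E ≠ 0 := by
    rw [← norm_pos_iff]
    exact lt_of_lt_of_le (by positivity) hlow
  rw [hD, inv_sub_inv (pow_ne_zero 2 hz0) hne, add_sub_cancel_left, norm_div, norm_mul, norm_pow]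
  rw [div_le_one (mul_pos (by positivity) (norm_pos_iff.2 hne))]
  calc ‖E‖ ≤ 5 / 48 * ‖z‖ ^ 4 := hEn
    _ ≤ ‖z‖ ^ 2 * (43 / 48 * ‖z‖ ^ 2) := by nlinarith [sq_nonneg (‖z‖ ^ 2)]
    _ ≤ _ := by gcongr

lemma norm_inv_sq_sub_le {z : ℂ} (hz : 0 < z.re) (h : |z.im| ≤ z.re) :
    ‖(z ^ 2)⁻¹ - exp z / (exp z - 1) ^ 2‖ ≤ 12 / (1 + z.re) ^ 2 := by
  have hsq : ‖z‖ ^ 2 = z.re ^ 2 + z.im ^ 2 := by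
    rw [← normSq_eq_norm_sq, normSq_apply]
    ring
  have him : z.im ^ 2 ≤ z.re ^ 2 := sq_le_sq' (neg_le_of_abs_le h) (le_of_abs_le h)
  have hre := re_le_norm z
  rcases le_or_gt ‖z‖ 1 with h1 | h1
  · refine (norm_inv_sq_sub_le_of_norm_le_one hz h1).trans ?_
    rw [le_div_iff₀ (by positivity)]
    nlinarith
  · have hx : 1 ≤ 2 * z.re ^ 2 := by nlinarith
    have hx1 : (1 + z.re) ^ 2 ≤ 6 * z.re ^ 2 := by
      have : (7 / 10 : ℝ) ≤ z.re := by nlinarith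
      nlinarith
    have ha : ‖(z ^ 2)⁻¹‖ ≤ 1 / z.re ^ 2 := by
      rw [norm_inv, norm_pow, ← one_div]
      gcongr
    refine (norm_sub_le _ _).trans ((add_le_add ha (norm_exp_div_sq_le hz)).trans ?_)
    rw [← two_mul, mul_one_div, div_le_div_iff₀ (by positivity) (by positivity)]
    linarith

lemma norm_bose_sub_inv_sub_le {x y : ℝ} (hx : 0 < x) (hy : |y| ≤ x) :
    ‖(bose (x - y * I) - ((x : ℂ) - y * I)⁻¹) - (bose x - (x : ℂ)⁻¹)‖
      ≤ 12 / (1 + x) ^ 2 * |y| := by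
  set S : Set ℂ := {z | z.re = x} ∩ ({z | z.im ≤ x} ∩ {z | -x ≤ z.im}) with hS
  have hconv : Convex ℝ S := by
    refine (convex_hyperplane reLm.isLinear x).inter
      ((convex_halfSpace_im_le x).inter (convex_halfSpace_im_ge (-x)))
  have hderiv : ∀ z ∈ S, HasDerivWithinAt (fun z => bose z - z⁻¹)
      (-exp z / (exp z - 1) ^ 2 - -(z ^ 2)⁻¹) S z := by
    rintro z ⟨hz, _⟩
    change z.re = x at hz
    have hz0 : 0 < z.re := by rwa [hz]
    have hzne : z ≠ 0 := fun h => by simp [h] at hz0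
    exact ((((hasDerivAt_exp z).sub_const 1).inv (exp_sub_one_ne_zero hz0)).sub
      (hasDerivAt_inv hzne)).hasDerivWithinAt
  have hbd : ∀ z ∈ S, ‖-exp z / (exp z - 1) ^ 2 - -(z ^ 2)⁻¹‖ ≤ 12 / (1 + x) ^ 2 := by
    rintro z ⟨hz, h1, h2⟩
    change z.re = x at hz
    have h := norm_inv_sq_sub_le (z := z) (by rwa [hz]) (by rw [hz]; exact abs_le.2 ⟨h2, h1⟩)
    rw [hz] at h
    convert h using 2
    ring
  have hxS : (x : ℂ) ∈ S := by
    refine ⟨ofReal_re x, ?_, ?_⟩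
    · change (x : ℂ).im ≤ x
      rw [ofReal_im]
      exact hx.le
    · change -x ≤ (x : ℂ).im
      rw [ofReal_im]
      linarith
  have hyS : ((x : ℂ) - y * I) ∈ S := by
    obtain ⟨h1, h2⟩ := abs_le.1 hy
    refine ⟨?_, ?_, ?_⟩
    · change ((x : ℂ) - y * I).re = x
      simp
    · change ((x : ℂ) - y * I).im ≤ x
      simp
      linarith
    · change -x ≤ ((x : ℂ) - y * I).im
      simp
      linarith
  have h := Convex.norm_image_sub_le_of_norm_hasDerivWithin_le hderiv hbd hconv hxS hyS
  simpa using h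

lemma sum_range_inv_one_add_sq_le {s : ℝ} (hs : 0 < s) (N : ℕ) :
    ∑ m ∈ Finset.range N, 1 / (1 + (m + 1) * s) ^ 2 ≤ 1 / s - 1 / (s * (1 + N * s)) := by
  induction N with
  | zero => simp
  | succ N ih =>
    rw [Finset.sum_range_succ]
    have h1 : 1 / (1 + ((N : ℝ) + 1) * s) ^ 2
        ≤ 1 / (s * (1 + N * s)) - 1 / (s * (1 + ((N : ℝ) + 1) * s)) := by
      have h2 : 1 / (s * (1 + N * s)) - 1 / (s * (1 + ((N : ℝ) + 1) * s))
          = 1 / ((1 + N * s) * (1 + ((N : ℝ) + 1) * s)) := by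
        field_simp
        ring
      rw [h2, sq]
      gcongr
      linarith
    push_cast
    linarith

/-- Main term of `logPart` near the positive real axis. -/
lemma norm_logPart_sub_le {s φ : ℝ} (hs : 0 < s) (hφ : |φ| ≤ s) :
    ‖logPart (s - φ * I) - logPart s - π ^ 2 / 6 * (((s : ℂ) - φ * I)⁻¹ - (s : ℂ)⁻¹)‖
      ≤ 12 * |φ| / s := by
  have hw : 0 < ((s : ℂ) - φ * I).re := by simpa using hs
  have hs' : 0 < (s : ℂ).re := by simpa using hs
  have hz : HasSum (fun m : ℕ => (((1 / ((m : ℝ) + 1) ^ 2 : ℝ)) : ℂ)) ((π ^ 2 / 6 : ℝ) : ℂ) := by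
    have h := hasSum_zeta_two
    rw [← hasSum_nat_add_iff' 1] at h
    simp only [Finset.range_one, Finset.sum_singleton, Nat.cast_zero, ne_eq, OfNat.ofNat_ne_zero,
      not_false_eq_true, zero_pow, div_zero, sub_zero] at h
    have := hasSum_ofReal.2 h
    simpa using this
  have h := ((hasSum_logPart hw).1.sub (hasSum_logPart hs').1).sub
    (hz.mul_right (((s : ℂ) - φ * I)⁻¹ - (s : ℂ)⁻¹))
  have hb : Summable fun m : ℕ => 1 / (1 + ((m : ℝ) + 1) * s) ^ 2 :=
    summable_of_sum_range_le (c := 1 / s) (fun m => by positivity) fun N =>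
      (sum_range_inv_one_add_sq_le hs N).trans (by
        have : 0 < 1 / (s * (1 + N * s)) := by positivity
        linarith)
  have hb1 : ∑' m : ℕ, 1 / (1 + ((m : ℝ) + 1) * s) ^ 2 ≤ 1 / s :=
    Real.tsum_le_of_sum_range_le (fun m => by positivity) fun N =>
      (sum_range_inv_one_add_sq_le hs N).trans (by
        have : 0 < 1 / (s * (1 + N * s)) := by positivity
        linarith)
  have h2 : ‖logPart (s - φ * I) - logPart s
      - ((π ^ 2 / 6 : ℝ) : ℂ) * (((s : ℂ) - φ * I)⁻¹ - (s : ℂ)⁻¹)‖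
      ≤ 12 * |φ| * ∑' m : ℕ, 1 / (1 + ((m : ℝ) + 1) * s) ^ 2 := by
    refine HasSum.norm_le_of_bounded h (hb.hasSum.mul_left _) fun m => ?_
    have hm : (0 : ℝ) < (m : ℝ) + 1 := by positivity
    have hmc : ((m : ℂ) + 1) ≠ 0 := by exact_mod_cast hm.ne'
    have h3 := norm_bose_sub_inv_sub_le (x := (m + 1) * s) (y := (m + 1) * φ) (by positivity) (by
      rw [abs_mul, abs_of_pos hm]
      gcongr)
    have hwne : (s : ℂ) - φ * I ≠ 0 := fun h0 => by simp [h0] at hw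
    have hsne : (s : ℂ) ≠ 0 := by exact_mod_cast hs.ne'
    have heq : bose (((m : ℂ) + 1) * (s - φ * I)) / (m + 1) - bose (((m : ℂ) + 1) * s) / (m + 1)
        - ((1 / ((m : ℝ) + 1) ^ 2 : ℝ) : ℂ) * (((s : ℂ) - φ * I)⁻¹ - (s : ℂ)⁻¹)
        = ((bose ((((m + 1) * s : ℝ) : ℂ) - (((m + 1) * φ : ℝ) : ℂ) * I)
          - ((((m + 1) * s : ℝ) : ℂ) - (((m + 1) * φ : ℝ) : ℂ) * I)⁻¹)
          - (bose (((m + 1) * s : ℝ) : ℂ) - (((m + 1) * s : ℝ) : ℂ)⁻¹)) / (m + 1) := by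
      have e1 : (((m + 1) * s : ℝ) : ℂ) - (((m + 1) * φ : ℝ) : ℂ) * I
          = ((m : ℂ) + 1) * (s - φ * I) := by
        push_cast
        ring
      rw [e1]
      push_cast
      rw [mul_inv, mul_inv]
      field_simp
      ring
    rw [heq, norm_div]
    have hn : ‖((m : ℂ) + 1)‖ = (m : ℝ) + 1 := by
      rw [← Nat.cast_succ, norm_natCast]
      push_cast
      rfl
    rw [hn, div_le_iff₀ hm]
    refine h3.trans (le_of_eq ?_)
    rw [abs_mul, abs_of_pos hm]
    ring
  push_cast at h2
  refine h2.trans ?_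
  rw [mul_div_assoc, div_eq_mul_one_div |φ| s, ← mul_assoc]
  gcongr

lemma norm_bose_sub_inv_le {z : ℂ} (hz : z ≠ 0) (h1 : ‖z‖ ≤ 1) : ‖bose z - z⁻¹‖ ≤ 3 := by
  have hn : 0 < ‖z‖ := norm_pos_iff.2 hz
  have h := exp_bound h1 (n := 2) (by norm_num)
  norm_num [Finset.sum_range_succ, Nat.factorial] at h
  have hE : ‖z - (exp z - 1)‖ ≤ ‖z‖ ^ 2 * (3 / 4) := by
    rw [norm_sub_rev, sub_sub]
    exact h
  have hlow : ‖z‖ / 4 ≤ ‖exp z - 1‖ := by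
    have h5 := norm_sub_norm_le z (z - (exp z - 1))
    rw [sub_sub_cancel] at h5
    nlinarith
  have hne : exp z - 1 ≠ 0 := by
    rw [← norm_pos_iff]
    linarith
  rw [bose, inv_sub_inv hne hz, norm_div, norm_mul,
    div_le_iff₀ (mul_pos (norm_pos_iff.2 hne) hn)]
  nlinarith

lemma bose_ofReal_re (x : ℝ) : (bose x).re = (Real.exp x - 1)⁻¹ := by
  rw [bose, ← ofReal_exp, ← ofReal_one, ← ofReal_sub, ← ofReal_inv, ofReal_re]

lemma bose_ofReal_re_le {x : ℝ} (hx : 0 < x) : (bose x).re ≤ 1 / x := by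
  rw [bose_ofReal_re, ← one_div]
  gcongr
  linarith [Real.add_one_le_exp x]

lemma norm_bose_le {z : ℂ} (hz : 0 < z.re) : ‖bose z‖ ≤ (bose z.re).re := by
  rw [bose_ofReal_re, bose, norm_inv]
  have h2 : 0 < Real.exp z.re - 1 := by linarith [Real.add_one_lt_exp hz.ne']
  exact inv_anti₀ h2 (exp_re_sub_one_le_norm z)

lemma re_logPart_sub_le {s φ : ℝ} (hs : 0 < s) :
    (logPart (s - φ * I)).re - (logPart s).re ≤ (bose (s - φ * I)).re - (bose s).re := by
  have hw : 0 < ((s : ℂ) - φ * I).re := by simpa using hs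
  have hs' : 0 < (s : ℂ).re := by simpa using hs
  have h := reCLM.hasSum ((hasSum_logPart hs').1.sub (hasSum_logPart hw).1)
  have h1 := le_hasSum h 0 fun m _ => by
    have hm : (0 : ℝ) < (m : ℝ) + 1 := by positivity
    have hre : (((m : ℂ) + 1) * ((s : ℂ) - φ * I)).re = (m + 1) * s := by
      rw [succ_mul_re]
      simp
    have h2 := norm_bose_le (z := ((m : ℂ) + 1) * ((s : ℂ) - φ * I)) (by rw [hre]; positivity)
    rw [hre] at h2
    have h3 := (re_le_norm _).trans h2
    have e : ((m : ℂ) + 1) = (((m : ℝ) + 1 : ℝ) : ℂ) := by push_cast; rfl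
    rw [reCLM_apply, ← sub_div]
    nth_rewrite 3 [e]
    rw [div_ofReal_re, sub_re]
    push_cast at h3
    exact div_nonneg (by linarith) hm.le
  simp only [reCLM_apply, sub_re, Nat.cast_zero, zero_add, one_mul, div_one] at h1
  linarith

lemma bose_re_sub_le {s φ : ℝ} (hs : 0 < s) (hs1 : s ≤ 1) (hφ : |φ| ≤ π) :
    (bose (s - φ * I)).re - (bose s).re ≤ -(φ ^ 2 / (s * (20 * s ^ 2 + 6 * φ ^ 2))) := by
  set a := Real.exp s with ha
  have ha1 : 1 + s ≤ a := by linarith [Real.add_one_le_exp s]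
  have ha2 : a ≤ 1 + 2 * s := by
    have h := Real.exp_bound' hs.le hs1 (n := 2) (by norm_num)
    norm_num [Finset.sum_range_succ, Nat.factorial] at h
    nlinarith
  set u := 1 - Real.cos φ with hu
  have hu1 : 2 / π ^ 2 * φ ^ 2 ≤ u := by linarith [Real.cos_le_one_sub_mul_cos_sq hφ]
  have hpi : π ^ 2 ≤ 10 := by nlinarith [Real.pi_lt_d2, Real.pi_pos]
  have hu2 : φ ^ 2 / 5 ≤ u := by
    refine le_trans ?_ hu1
    rw [div_mul_eq_mul_div, div_le_div_iff₀ (by norm_num) (by positivity)]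
    nlinarith [sq_nonneg φ]
  have hu0 : 0 ≤ u := le_trans (by positivity) hu2
  have hcos : Real.cos φ = 1 - u := by rw [hu]; ring
  have hsin : Real.sin φ ^ 2 = 1 - (1 - u) ^ 2 := by
    rw [← hcos]
    linarith [Real.sin_sq_add_cos_sq φ]
  have hD : 0 < (a - 1) ^ 2 + 2 * a * u := by
    have : 0 < a - 1 := by linarith
    positivity
  have h1 : (bose (s - φ * I)).re = (a - 1 - a * u) / ((a - 1) ^ 2 + 2 * a * u) := by
    rw [bose, inv_re, normSq_apply]
    have e1 : (exp (s - φ * I) - 1).re = a - 1 - a * u := by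
      rw [sub_re, exp_re, one_re]
      simp [hcos, ha]
      ring
    have e2 : (exp (s - φ * I) - 1).im = -(a * Real.sin φ) := by
      rw [sub_im, exp_im, one_im]
      simp [ha]
    rw [e1, e2]
    congr 1
    linear_combination a ^ 2 * hsin
  have h2 : (bose s).re = 1 / (a - 1) := by rw [bose_ofReal_re, one_div]
  have ha0 : 0 < a - 1 := by linarith
  have h3 : (bose (s - φ * I)).re - (bose s).re
      = -(a * (a + 1) * u / ((a - 1) * ((a - 1) ^ 2 + 2 * a * u))) := by
    rw [h1, h2, div_sub_div _ _ hD.ne' ha0.ne', ← neg_div,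
      div_eq_div_iff (by positivity) (by positivity)]
    ring
  rw [h3, neg_le_neg_iff]
  calc φ ^ 2 / (s * (20 * s ^ 2 + 6 * φ ^ 2)) ≤ 2 * u / (2 * s * (4 * s ^ 2 + 6 * u)) := by
        rw [div_le_div_iff₀ (by positivity) (by positivity)]
        have h5 : φ ^ 2 * (4 * s ^ 2) ≤ u * (20 * s ^ 2) := by nlinarith [sq_nonneg s]
        have h6 : φ ^ 2 * (4 * s ^ 2 + 6 * u) ≤ u * (20 * s ^ 2 + 6 * φ ^ 2) := by linarith
        nlinarith
    _ ≤ a * (a + 1) * u / ((a - 1) * ((a - 1) ^ 2 + 2 * a * u)) := by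
        refine div_le_div₀ (by positivity) ?_ (by positivity) ?_
        · nlinarith
        · have h7 : (a - 1) ^ 2 ≤ 4 * s ^ 2 := by nlinarith
          have h8 : 2 * a * u ≤ 6 * u := by nlinarith
          exact mul_le_mul (by linarith) (by linarith) hD.le (by linarith)

lemma norm_exp_mul_I_sub_one_le (y : ℝ) : ‖exp (y * I) - 1‖ ≤ |y| := by
  have h := Real.norm_exp_I_mul_ofReal_sub_one_le (x := y)
  rwa [mul_comm, Real.norm_eq_abs] at h

lemma abs_bose_im_le {x u : ℝ} (hx : 0 < x) : |(bose (x - u * I)).im| ≤ |u| / x ^ 2 := by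
  have hre : ((x : ℂ) - u * I).re = x := by simp
  rw [bose, inv_im, normSq_eq_norm_sq, abs_div, abs_neg, abs_of_nonneg (sq_nonneg ‖_‖)]
  have h1 := exp_re_sub_one_le_norm ((x : ℂ) - u * I)
  rw [hre] at h1
  have h2 : 0 < Real.exp x - 1 := by linarith [Real.add_one_lt_exp hx.ne']
  have h3 : |(exp ((x : ℂ) - u * I) - 1).im| ≤ Real.exp x * |u| := by
    rw [sub_im, exp_im, one_im, hre, sub_zero, abs_mul, abs_of_pos (Real.exp_pos x)]
    have : ((x : ℂ) - u * I).im = -u := by simp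
    rw [this, Real.sin_neg, abs_neg]
    have := Real.abs_sin_le_abs (x := u)
    gcongr
  calc |(exp ((x : ℂ) - u * I) - 1).im| / ‖exp ((x : ℂ) - u * I) - 1‖ ^ 2
      ≤ Real.exp x * |u| / (Real.exp x - 1) ^ 2 := by gcongr
    _ ≤ |u| / x ^ 2 := by
      rw [div_le_div_iff₀ (by positivity) (by positivity)]
      have := mul_le_mul_of_nonneg_left (sq_mul_exp_le hx.le) (abs_nonneg u)
      linarith

lemma re_logTwist_le {x u y : ℝ} (hx : 0 < x) (hy : |y| ≤ 1 / 2) :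
    (logTwist (exp (y * I) - 1) (x - u * I)).re
      ≤ 2 * y ^ 2 / x + |y| * min (1 / x) (|u| / x ^ 2) := by
  set z := exp (y * I) - 1 with hz
  set W := (x : ℂ) - u * I with hW
  have hre : W.re = x := by simp [hW]
  have hWre : 0 < W.re := by rwa [hre]
  have hzy : ‖z‖ ≤ |y| := norm_exp_mul_I_sub_one_le y
  have hb := norm_bose_le hWre
  rw [hre] at hb
  have hb2 := hb.trans (bose_ofReal_re_le hx)
  have h2W : (2 * W).re = 2 * x := by simp [hre]
  have hb3 : ‖bose (2 * W)‖ ≤ 1 / (2 * x) := by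
    have h := norm_bose_le (z := 2 * W) (by rw [h2W]; positivity)
    rw [h2W] at h
    exact h.trans (bose_ofReal_re_le (by positivity))
  have h1 := norm_logTwist_sub_le (hzy.trans hy) hWre
  rw [hre] at h1
  have h2 := (re_le_norm _).trans (h1.trans (mul_le_mul_of_nonneg_left (bose_ofReal_re_le hx)
    (by positivity)))
  rw [sub_re, sub_re] at h2
  have h3 : -(z ^ 2 / 2 * bose (2 * W)).re ≤ y ^ 2 / (4 * x) := by
    refine (neg_le_abs _).trans ((abs_re_le_norm _).trans ?_)
    rw [norm_mul, norm_div, norm_pow, norm_ofNat]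
    calc ‖z‖ ^ 2 / 2 * ‖bose (2 * W)‖ ≤ |y| ^ 2 / 2 * (1 / (2 * x)) := by gcongr
      _ = y ^ 2 / (4 * x) := by rw [sq_abs]; ring
  have hzre : |z.re| ≤ y ^ 2 / 2 := by
    have e : z.re = Real.cos y - 1 := by rw [hz, sub_re, exp_ofReal_mul_I_re, one_re]
    rw [e, abs_le]
    constructor
    · linarith [Real.one_sub_sq_div_two_le_cos (x := y)]
    · linarith [Real.cos_le_one y, sq_nonneg y]
  have hzim : |z.im| ≤ |y| := (abs_im_le_norm z).trans hzy
  have h4 : (z * bose W).re ≤ y ^ 2 / 2 * (1 / x) + |y| * min (1 / x) (|u| / x ^ 2) := by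
    rw [mul_re]
    have ha : z.re * (bose W).re ≤ y ^ 2 / 2 * (1 / x) := by
      refine (le_abs_self _).trans ?_
      rw [abs_mul]
      exact mul_le_mul hzre ((abs_re_le_norm _).trans hb2) (abs_nonneg _) (by positivity)
    have hc : -(z.im * (bose W).im) ≤ |y| * min (1 / x) (|u| / x ^ 2) := by
      refine (neg_le_abs _).trans ?_
      rw [abs_mul]
      exact mul_le_mul hzim (le_min ((abs_im_le_norm _).trans hb2) (abs_bose_im_le hx))
        (abs_nonneg _) (abs_nonneg _)
    linarith
  have h5 : ‖z‖ ^ 3 * (1 / x) ≤ y ^ 2 / 2 * (1 / x) := by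
    have : ‖z‖ ^ 3 ≤ y ^ 2 / 2 := by
      calc ‖z‖ ^ 3 = ‖z‖ ^ 2 * ‖z‖ := by ring
        _ ≤ |y| ^ 2 * (1 / 2) := by
          have := hzy.trans hy
          gcongr
        _ = y ^ 2 / 2 := by rw [sq_abs]; ring
    gcongr
  have h6 : 2 * y ^ 2 / x = y ^ 2 / 2 * (1 / x) + y ^ 2 / 2 * (1 / x) + y ^ 2 / (4 * x)
      + 3 * y ^ 2 / (4 * x) := by
    field_simp
    ring
  have h7 : 0 ≤ 3 * y ^ 2 / (4 * x) := by positivity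
  linarith

lemma natCast_mul_re_logTwist_le (t : ℕ) (ht : 1 ≤ t) {s φ y : ℝ} (hs : 0 < s) (hy : |y| ≤ 1 / 2) :
    (t * logTwist (exp (y * I) - 1) (t * (s - φ * I))).re
      ≤ 2 * y ^ 2 / s + |y| * min (1 / s) (|φ| / s ^ 2) := by
  have ht0 : (0 : ℝ) < t := by exact_mod_cast ht
  have h := re_logTwist_le (x := t * s) (u := t * φ) (y := y) (by positivity) hy
  have e : (((t * s : ℝ)) : ℂ) - ((t * φ : ℝ) : ℂ) * I = t * (s - φ * I) := by
    push_cast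
    ring
  rw [e] at h
  have e2 : (t * logTwist (exp (y * I) - 1) (t * (s - φ * I))).re
      = t * (logTwist (exp (y * I) - 1) (t * (s - φ * I))).re := by simp
  rw [e2]
  refine (mul_le_mul_of_nonneg_left h ht0.le).trans (le_of_eq ?_)
  rw [mul_add, mul_left_comm _ |y|, mul_min_of_nonneg _ _ ht0.le, abs_mul, abs_of_pos ht0]
  have e3 : t * (2 * y ^ 2 / (t * s)) = 2 * y ^ 2 / s := by field_simp
  have e4 : t * (1 / (t * s)) = 1 / s := by field_simp
  have e5 : t * (t * |φ| / (t * s) ^ 2) = |φ| / s ^ 2 := by field_simp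
  rw [e3, e4, e5]

/-- The constant `π / √6`. -/
noncomputable def kap : ℝ := π / Real.sqrt 6

lemma kap_pos : 0 < kap := by
  unfold kap
  positivity

lemma kap_sq : kap ^ 2 = π ^ 2 / 6 := by
  unfold kap
  rw [div_pow, Real.sq_sqrt (by norm_num)]

lemma one_le_kap : 1 ≤ kap := by
  have h := kap_sq
  have := Real.pi_gt_d2
  nlinarith [kap_pos]

lemma kap_le : kap ≤ 13 / 10 := by
  have h := kap_sq
  have := Real.pi_lt_d2
  nlinarith [kap_pos, Real.pi_pos]

/-- The saddle point for the scale `N = n^{1/4}`. -/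
noncomputable def saddle (N v : ℝ) : ℂ := ((kap / N ^ 2 : ℝ) : ℂ) - ((v / N ^ 3 : ℝ) : ℂ) * I

/-- The exponent of the rescaled integrand. -/
noncomputable def expo (t : ℕ) (θ N v : ℝ) : ℂ :=
  logPart (saddle N v) - logPart ((kap / N ^ 2 : ℝ) : ℂ)
    + t * logTwist (exp ((θ / N : ℝ) * I) - 1) (t * saddle N v)
    - I * (N * v) - I * (θ / N * (N ^ 2 / kap - t / 2))

lemma one_add_poly_mul_exp_le {θ x : ℝ} :
    (1 + x ^ 2 + 10 * x ^ 6) * Real.exp (|θ| * x - x ^ 2 / 100)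
      ≤ 10 ^ 9 * Real.exp (50 * θ ^ 2) := by
  have h1 : |θ| * x - x ^ 2 / 100 ≤ 50 * θ ^ 2 - x ^ 2 / 200 := by
    nlinarith [sq_nonneg (100 * |θ| - x), sq_abs θ]
  have ha : (0 : ℝ) ≤ x ^ 2 / 200 := by positivity
  have h2 := Real.pow_div_factorial_le_exp _ ha 1
  have h3 := Real.pow_div_factorial_le_exp _ ha 3
  have h4 := Real.one_le_exp ha
  norm_num [Nat.factorial] at h2 h3
  have h5 : 1 + x ^ 2 + 10 * x ^ 6 ≤ 10 ^ 9 * Real.exp (x ^ 2 / 200) := by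
    have : x ^ 6 = (x ^ 2 / 200) ^ 3 / 6 * (6 * 200 ^ 3) := by ring
    rw [this]
    linarith
  calc (1 + x ^ 2 + 10 * x ^ 6) * Real.exp (|θ| * x - x ^ 2 / 100)
      ≤ 10 ^ 9 * Real.exp (x ^ 2 / 200) * Real.exp (50 * θ ^ 2 - x ^ 2 / 200) := by gcongr
    _ = 10 ^ 9 * Real.exp (50 * θ ^ 2) := by
      rw [mul_assoc, ← Real.exp_add]
      ring_nf

lemma re_expo_le (t : ℕ) (ht : 1 ≤ t) {θ N v : ℝ} (hN : 2 ≤ N) (hθ : 2 * |θ| ≤ N)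
    (hv : |v| ≤ π * N ^ 3) :
    (expo t θ N v).re ≤ 2 * θ ^ 2 + (|θ| * min |v| N - min |v| N ^ 2 / 100) := by
  have hN0 : 0 < N := by linarith
  have hk := kap_pos
  have hk1 := one_le_kap
  have hk2 := kap_le
  set s := kap / N ^ 2 with hs
  set φ := v / N ^ 3 with hφ
  have hs0 : 0 < s := by positivity
  have hs1 : s ≤ 1 := by
    rw [hs, div_le_one (by positivity)]
    nlinarith
  have hφπ : |φ| ≤ π := by
    rw [hφ, abs_div, abs_of_pos (show 0 < N ^ 3 by positivity), div_le_iff₀ (by positivity)]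
    exact hv
  have hy : |θ / N| ≤ 1 / 2 := by
    rw [abs_div, abs_of_pos hN0, div_le_iff₀ hN0]
    linarith
  have h1 := (re_logPart_sub_le (φ := φ) hs0).trans (bose_re_sub_le hs0 hs1 hφπ)
  have h2 := natCast_mul_re_logTwist_le t ht (φ := φ) hs0 hy
  have hre : (expo t θ N v).re = (logPart (s - φ * I)).re - (logPart s).re
      + (t * logTwist (exp ((θ / N : ℝ) * I) - 1) (t * (s - φ * I))).re := by
    have e1 : (I * ((N : ℂ) * v)).re = 0 := by
      rw [← ofReal_mul]
      simp
    have e2 : (I * ((θ : ℂ) / N * ((N : ℂ) ^ 2 / kap - t / 2))).re = 0 := by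
      have : ((θ : ℂ) / N * ((N : ℂ) ^ 2 / kap - t / 2))
        = ((θ / N * (N ^ 2 / kap - t / 2) : ℝ) : ℂ) := by push_cast; rfl
      rw [this, mul_comm, re_ofReal_mul, I_re, mul_zero]
    rw [expo, sub_re, sub_re, e1, e2, add_re, sub_re]
    simp only [sub_zero]
    rfl
  rw [hre]
  set x := min |v| N with hx
  have hxv : x ≤ |v| := min_le_left _ _
  have hxN : x ≤ N := min_le_right _ _
  have hx0 : 0 ≤ x := le_min (abs_nonneg v) hN0.le
  have h3 : x ^ 2 / 100 ≤ φ ^ 2 / (s * (20 * s ^ 2 + 6 * φ ^ 2)) := by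
    rw [div_le_div_iff₀ (by norm_num) (by positivity)]
    have hxv2 : x ^ 2 ≤ v ^ 2 := by
      rw [← sq_abs v]
      gcongr
    have hxN2 : x ^ 2 ≤ N ^ 2 := by gcongr
    have e : x ^ 2 * (s * (20 * s ^ 2 + 6 * φ ^ 2))
        = kap * (20 * kap ^ 2 * (x ^ 2 * N ^ 2) + 6 * (x ^ 2 * v ^ 2)) / N ^ 8 := by
      rw [hs, hφ]
      field_simp
    have e2 : φ ^ 2 * 100 = 100 * (v ^ 2 * N ^ 2) / N ^ 8 := by
      rw [hφ]
      field_simp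
    rw [e, e2]
    have i1 : x ^ 2 * N ^ 2 ≤ v ^ 2 * N ^ 2 := by gcongr
    have i2 : x ^ 2 * v ^ 2 ≤ v ^ 2 * N ^ 2 := by
      rw [mul_comm]
      gcongr
    have i3 : kap ^ 2 ≤ 2 := by nlinarith
    have i0 : 0 ≤ v ^ 2 * N ^ 2 := by positivity
    have i5 : 20 * kap ^ 2 * (x ^ 2 * N ^ 2) + 6 * (x ^ 2 * v ^ 2) ≤ 46 * (v ^ 2 * N ^ 2) := by
      have : kap ^ 2 * (x ^ 2 * N ^ 2) ≤ 2 * (v ^ 2 * N ^ 2) := by gcongr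
      linarith
    have i6 : kap * (20 * kap ^ 2 * (x ^ 2 * N ^ 2) + 6 * (x ^ 2 * v ^ 2))
        ≤ 100 * (v ^ 2 * N ^ 2) :=
      (mul_le_mul_of_nonneg_left i5 hk.le).trans (by nlinarith)
    exact div_le_div_of_nonneg_right i6 (by positivity)
  have h4 : 2 * (θ / N) ^ 2 / s ≤ 2 * θ ^ 2 := by
    have : 2 * (θ / N) ^ 2 / s = 2 * θ ^ 2 / kap := by
      rw [hs]
      field_simp
    rw [this]
    exact div_le_self (by positivity) hk1
  have h5 : |θ / N| * min (1 / s) (|φ| / s ^ 2) ≤ |θ| * x := by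
    have e1 : |θ / N| * (1 / s) = |θ| * (N / kap) := by
      rw [hs, abs_div, abs_of_pos hN0]
      field_simp
    have e2 : |θ / N| * (|φ| / s ^ 2) = |θ| * (|v| / kap ^ 2) := by
      rw [hs, hφ, abs_div, abs_div, abs_of_pos hN0, abs_of_pos (show 0 < N ^ 3 by positivity)]
      field_simp
    rw [mul_min_of_nonneg _ _ (abs_nonneg _), e1, e2, ← mul_min_of_nonneg _ _ (abs_nonneg _)]
    refine mul_le_mul_of_nonneg_left ?_ (abs_nonneg _)
    refine le_min ((min_le_right _ _).trans (div_le_self (abs_nonneg _) (by nlinarith)))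
      ((min_le_left _ _).trans (div_le_self hN0.le hk1))
  linarith

lemma norm_exp_expo_le (t : ℕ) (ht : 1 ≤ t) {θ N v : ℝ} (hN : 2 ≤ N) (hθ : 2 * |θ| ≤ N)
    (hv : |v| ≤ π * N ^ 3) :
    ‖exp (expo t θ N v)‖ ≤ 10 ^ 9 * Real.exp (52 * θ ^ 2) * (1 + v ^ 2)⁻¹ := by
  have h1 := re_expo_le t ht hN hθ hv
  set x := min |v| N with hx
  have h2 : 1 + v ^ 2 ≤ 1 + x ^ 2 + 10 * x ^ 6 := by
    rcases le_total |v| N with h | h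
    · rw [hx, min_eq_left h, sq_abs]
      have : 0 ≤ 10 * |v| ^ 6 := by positivity
      linarith
    · rw [hx, min_eq_right h, ← sq_abs v]
      have h3 : |v| ^ 2 ≤ (π * N ^ 3) ^ 2 := by gcongr
      have hpi : π ^ 2 ≤ 10 := by nlinarith [Real.pi_lt_d2, Real.pi_pos]
      have h4 : (π * N ^ 3) ^ 2 ≤ 10 * N ^ 6 := by
        have : (π * N ^ 3) ^ 2 = π ^ 2 * N ^ 6 := by ring
        rw [this]
        gcongr
      have : 0 ≤ N ^ 2 := sq_nonneg N
      linarith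
  rw [norm_exp, ← div_eq_mul_inv, le_div_iff₀ (by positivity)]
  calc Real.exp (expo t θ N v).re * (1 + v ^ 2)
      ≤ Real.exp (2 * θ ^ 2 + (|θ| * x - x ^ 2 / 100)) * (1 + x ^ 2 + 10 * x ^ 6) := by gcongr
    _ = Real.exp (2 * θ ^ 2) * ((1 + x ^ 2 + 10 * x ^ 6) * Real.exp (|θ| * x - x ^ 2 / 100)) := by
      rw [Real.exp_add]
      ring
    _ ≤ Real.exp (2 * θ ^ 2) * (10 ^ 9 * Real.exp (50 * θ ^ 2)) :=
      mul_le_mul_of_nonneg_left one_add_poly_mul_exp_le (Real.exp_pos _).le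
    _ = 10 ^ 9 * Real.exp (52 * θ ^ 2) := by
      rw [mul_left_comm, ← Real.exp_add]
      ring_nf

lemma tendsto_const_div_atTop (c : ℂ) : Tendsto (fun N : ℝ => c / N) atTop (nhds 0) := by
  rw [tendsto_zero_iff_norm_tendsto_zero]
  have h : Tendsto (fun N : ℝ => ‖c‖ / N) atTop (nhds 0) :=
    tendsto_const_nhds.div_atTop tendsto_id
  refine h.congr' ?_
  filter_upwards [eventually_gt_atTop 0] with N hN
  rw [norm_div, norm_real, Real.norm_of_nonneg hN.le]

lemma tendsto_zero_of_norm_le_div {f : ℝ → ℂ} (c : ℝ) (h : ∀ᶠ N in atTop, ‖f N‖ ≤ c / N) :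
    Tendsto f atTop (nhds 0) :=
  squeeze_zero_norm' h (tendsto_const_nhds.div_atTop tendsto_id)

lemma tendsto_sq_mul_exp_sub (θ : ℝ) :
    Tendsto (fun N : ℝ => (N : ℂ) ^ 2 * (exp ((θ / N : ℝ) * I) - 1 - (θ / N : ℝ) * I)) atTop
      (nhds (-(θ : ℂ) ^ 2 / 2)) := by
  have h : Tendsto (fun N : ℝ => (N : ℂ) ^ 2 * (exp ((θ / N : ℝ) * I) - 1 - (θ / N : ℝ) * I)
      - (-(θ : ℂ) ^ 2 / 2)) atTop (nhds 0) := by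
    refine tendsto_zero_of_norm_le_div (|θ| ^ 3) ?_
    filter_upwards [eventually_ge_atTop (1 + |θ|)] with N hN
    have hN0 : 0 < N := by linarith [abs_nonneg θ]
    have hx : ‖((θ / N : ℝ) : ℂ) * I‖ = |θ| / N := by
      rw [norm_mul, norm_I, mul_one, norm_real, Real.norm_eq_abs, abs_div, abs_of_pos hN0]
    have hb := exp_bound (x := ((θ / N : ℝ) : ℂ) * I) (n := 3)
      (by rw [hx, div_le_one hN0]; linarith) (by norm_num)
    have e : (N : ℂ) ^ 2 * (exp ((θ / N : ℝ) * I) - 1 - (θ / N : ℝ) * I) - (-(θ : ℂ) ^ 2 / 2)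
        = (N : ℂ) ^ 2 * (exp ((θ / N : ℝ) * I)
          - ∑ m ∈ Finset.range 3, (((θ / N : ℝ) : ℂ) * I) ^ m / (m.factorial : ℂ)) := by
      have hN' : (N : ℂ) ≠ 0 := ofReal_ne_zero.mpr hN0.ne'
      simp only [Finset.sum_range_succ, Finset.sum_range_zero, Nat.factorial]
      push_cast
      field_simp
      rw [I_sq]
      ring
    rw [e, norm_mul, norm_pow, norm_real, Real.norm_of_nonneg hN0.le]
    rw [hx] at hb
    calc N ^ 2 * _ ≤ N ^ 2 * ((|θ| / N) ^ 3 * 1) := by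
          refine mul_le_mul_of_nonneg_left (hb.trans ?_) (by positivity)
          refine mul_le_mul_of_nonneg_left ?_ (by positivity)
          norm_num [Nat.factorial]
      _ = |θ| ^ 3 / N := by
          field_simp
  have h' := h.add_const (-(θ : ℂ) ^ 2 / 2)
  simp only [sub_add_cancel, zero_add] at h'
  exact h'

lemma tendsto_mul_exp_sub (θ : ℝ) :
    Tendsto (fun N : ℝ => (N : ℂ) * (exp ((θ / N : ℝ) * I) - 1)) atTop (nhds (θ * I)) := by
  have h := ((tendsto_sq_mul_exp_sub θ).mul (tendsto_const_div_atTop 1)).add_const ((θ : ℂ) * I)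
  rw [mul_zero, zero_add] at h
  refine h.congr' ?_
  filter_upwards [eventually_gt_atTop 0] with N hN
  have hN' : (N : ℂ) ≠ 0 := ofReal_ne_zero.mpr hN.ne'
  push_cast
  field_simp
  ring

lemma tendsto_exp_sub_one (θ : ℝ) :
    Tendsto (fun N : ℝ => exp ((θ / N : ℝ) * I) - 1) atTop (nhds 0) := by
  refine tendsto_zero_of_norm_le_div |θ| ?_
  filter_upwards [eventually_gt_atTop 0] with N hN
  have := norm_exp_mul_I_sub_one_le (θ / N)
  rwa [abs_div, abs_of_pos hN] at this

lemma saddle_eq {N : ℝ} (hN : 0 < N) (v : ℝ) :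
    saddle N v = kap / N ^ 2 * (1 - v / kap / N * I) := by
  have hN' : (N : ℂ) ≠ 0 := ofReal_ne_zero.mpr hN.ne'
  have hk : (kap : ℂ) ≠ 0 := ofReal_ne_zero.mpr kap_pos.ne'
  rw [saddle]
  push_cast
  field_simp

lemma saddle_re (N v : ℝ) : (saddle N v).re = kap / N ^ 2 := by
  rw [saddle, sub_re, ofReal_re, re_ofReal_mul, I_re]
  ring

lemma tendsto_saddle (v : ℝ) : Tendsto (fun N : ℝ => saddle N v) atTop (nhds 0) := by
  have h := (((tendsto_const_div_atTop kap).mul (tendsto_const_div_atTop 1)).mul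
    (((tendsto_const_div_atTop (v / kap)).mul_const I).const_sub 1))
  rw [mul_zero, zero_mul] at h
  refine h.congr' ?_
  filter_upwards [eventually_gt_atTop 0] with N hN
  rw [saddle_eq hN]
  ring

lemma tendsto_mul_bose_sub (c : ℝ) (hc : 0 < c) (v : ℝ) {f : ℝ → ℂ}
    (hf : Tendsto f atTop (nhds 0)) :
    Tendsto (fun N : ℝ => f N * (bose (c * saddle N v) - (c * saddle N v)⁻¹)) atTop (nhds 0) := by
  rw [tendsto_zero_iff_norm_tendsto_zero] at hf ⊢
  have h3 : Tendsto (fun N => ‖f N‖ * 3) atTop (nhds 0) := by simpa using hf.mul_const 3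
  have h1 : ∀ᶠ N in atTop, ‖(c : ℂ) * saddle N v‖ < 1 := by
    have := ((tendsto_saddle v).const_mul (c : ℂ)).norm
    rw [mul_zero, norm_zero] at this
    exact this.eventually (gt_mem_nhds one_pos)
  refine squeeze_zero' (Eventually.of_forall fun N => norm_nonneg _) ?_ h3
  filter_upwards [h1, eventually_gt_atTop 0] with N hN hN0
  rw [norm_mul]
  refine mul_le_mul_of_nonneg_left (norm_bose_sub_inv_le ?_ hN.le) (norm_nonneg _)
  intro h0
  have := congrArg re h0
  rw [re_ofReal_mul, saddle_re, zero_re] at this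
  have hk := kap_pos
  have : 0 < c * (kap / N ^ 2) := by positivity
  linarith

lemma tendsto_logPart_saddle_sub (v : ℝ) :
    Tendsto (fun N : ℝ => logPart (saddle N v) - logPart ((kap / N ^ 2 : ℝ) : ℂ)
      - π ^ 2 / 6 * ((saddle N v)⁻¹ - (((kap / N ^ 2 : ℝ) : ℂ))⁻¹)) atTop (nhds 0) := by
  have hk := kap_pos
  refine tendsto_zero_of_norm_le_div (12 * |v| / kap) ?_
  filter_upwards [eventually_gt_atTop 0, eventually_ge_atTop (|v| / kap)] with N hN0 hN
  rw [div_le_iff₀ hk] at hN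
  have h := norm_logPart_sub_le (s := kap / N ^ 2) (φ := v / N ^ 3) (by positivity) (by
    rw [abs_div, abs_of_pos (show 0 < N ^ 3 by positivity), div_le_div_iff₀ (by positivity)
      (by positivity)]
    calc |v| * N ^ 2 ≤ N * kap * N ^ 2 := by gcongr
      _ = kap * N ^ 3 := by ring)
  refine h.trans (le_of_eq ?_)
  rw [abs_div, abs_of_pos (show 0 < N ^ 3 by positivity)]
  field_simp

lemma tendsto_logTwist_saddle_sub (t : ℕ) (ht : 1 ≤ t) (θ v : ℝ) :
    Tendsto (fun N : ℝ => logTwist (exp ((θ / N : ℝ) * I) - 1) (t * saddle N v)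
      - ((exp ((θ / N : ℝ) * I) - 1) * bose (t * saddle N v)
        - (exp ((θ / N : ℝ) * I) - 1) ^ 2 / 2 * bose (2 * (t * saddle N v)))) atTop (nhds 0) := by
  have hk := kap_pos
  have ht0 : (1 : ℝ) ≤ t := by exact_mod_cast ht
  refine tendsto_zero_of_norm_le_div (|θ| ^ 3 / kap) ?_
  filter_upwards [eventually_gt_atTop 0, eventually_ge_atTop (2 * |θ|)] with N hN0 hN
  have hz := norm_exp_mul_I_sub_one_le (θ / N)
  rw [abs_div, abs_of_pos hN0] at hz
  have hre : ((t : ℂ) * saddle N v).re = t * (kap / N ^ 2) := by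
    rw [← ofReal_natCast, re_ofReal_mul, saddle_re]
  have hp : 0 < t * (kap / N ^ 2) := by positivity
  refine (norm_logTwist_sub_le (hz.trans ?_) (hre ▸ hp)).trans ?_
  · rw [div_le_div_iff₀ hN0 two_pos]
    linarith
  · rw [hre]
    calc _ ≤ (|θ| / N) ^ 3 * (1 / (t * (kap / N ^ 2))) := by
          refine mul_le_mul (pow_le_pow_left₀ (norm_nonneg _) hz 3) (bose_ofReal_re_le hp) ?_
            (by positivity)
          rw [bose_ofReal_re]
          exact inv_nonneg.mpr (sub_nonneg.mpr (Real.one_le_exp hp.le))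
      _ ≤ (|θ| / N) ^ 3 * (1 / (1 * (kap / N ^ 2))) := by gcongr
      _ = _ := by field_simp

lemma expo_algebra {k M r t v θ L L' T b1 b2 e : ℂ} (hk : k ≠ 0) (hM : M ≠ 0) (ht : t ≠ 0)
    (h : M * k * (r - 1) = v * I * r) :
    L - L' - 6 * k ^ 2 / 6 * (M ^ 2 / k * r - (k / M ^ 2)⁻¹)
      + t * (T - ((e - 1) * b1 - (e - 1) ^ 2 / 2 * b2))
      + t * (e - 1) * (b1 - t⁻¹ * (M ^ 2 / k * r))
      - t / 2 * (e - 1) ^ 2 * (b2 - 2⁻¹ * t⁻¹ * (M ^ 2 / k * r))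
      + (-(v ^ 2 / k) * r + k⁻¹ * (M ^ 2 * (e - 1 - θ / M * I) * r - θ * v / k * r)
        - (M * (e - 1)) ^ 2 * r / (4 * k) + I * θ * t / 2 / M)
    = L - L' + t * T - I * (M * v) - I * (θ / M * (M ^ 2 / k - t / 2)) := by
  field_simp
  linear_combination (-16 * M * (k ^ 2 * M + k * v * I + I * θ)) * h
    - 16 * M * (k * v ^ 2 * r + θ * v * r) * I_sq

lemma tendsto_expo (t : ℕ) (ht : 1 ≤ t) (θ v : ℝ) :
    Tendsto (fun N : ℝ => expo t θ N v) atTop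
      (nhds (-((v : ℂ) ^ 2 / kap + v * θ / kap ^ 2 + θ ^ 2 / (4 * kap)))) := by
  have hk : (kap : ℂ) ≠ 0 := ofReal_ne_zero.mpr kap_pos.ne'
  have ht0 : (0 : ℝ) < t := by exact_mod_cast ht
  have hz := tendsto_exp_sub_one θ
  have hr : Tendsto (fun N : ℝ => (1 - (v : ℂ) / kap / N * I)⁻¹) atTop (nhds 1) := by
    have := ((tendsto_const_div_atTop ((v : ℂ) / kap)).mul_const I).const_sub 1
    rw [zero_mul, sub_zero] at this
    simpa using this.inv₀ one_ne_zero
  have hP := tendsto_sq_mul_exp_sub θ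
  have hQ := (tendsto_mul_exp_sub θ).pow 2
  have hA := tendsto_logPart_saddle_sub v
  have hC := (tendsto_logTwist_saddle_sub t ht θ v).const_mul (t : ℂ)
  have hD1 := tendsto_mul_bose_sub t ht0 v
    (f := fun N : ℝ => (t : ℂ) * (exp ((θ / N : ℝ) * I) - 1))
    (by simpa using hz.const_mul (t : ℂ))
  have hD2 := tendsto_mul_bose_sub (2 * t) (by positivity) v
    (f := fun N : ℝ => (t / 2 : ℂ) * (exp ((θ / N : ℝ) * I) - 1) ^ 2)
    (by simpa using (hz.pow 2).const_mul (t / 2 : ℂ))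
  have hF := (((hr.const_mul (-((v : ℂ) ^ 2 / kap))).add
    (((hP.mul hr).sub (hr.const_mul ((θ : ℂ) * v / kap))).const_mul ((kap : ℂ)⁻¹))).sub
    ((hQ.mul hr).div_const (4 * (kap : ℂ)))).add (tendsto_const_div_atTop (I * θ * t / 2))
  have hT := (((hA.add hC).add hD1).sub hD2).add hF
  have hlim : (0 + (t : ℂ) * 0 + 0 - 0 + (-((v : ℂ) ^ 2 / kap) * 1
      + (kap : ℂ)⁻¹ * (-(θ : ℂ) ^ 2 / 2 * 1 - (θ : ℂ) * v / kap * 1)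
      - (θ * I) ^ 2 * 1 / (4 * (kap : ℂ)) + 0))
      = -((v : ℂ) ^ 2 / kap + v * θ / kap ^ 2 + θ ^ 2 / (4 * kap)) := by
    rw [mul_pow, I_sq]
    field_simp
    ring
  rw [hlim] at hT
  refine hT.congr' ?_
  filter_upwards [eventually_gt_atTop 0] with N hN
  have hN' : (N : ℂ) ≠ 0 := ofReal_ne_zero.mpr hN.ne'
  have htc : (t : ℂ) ≠ 0 := by exact_mod_cast ht0.ne'
  have hr0 : (1 - (v : ℂ) / kap / N * I) ≠ 0 := by
    intro h
    have := congrArg re h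
    have e : (v : ℂ) / kap / N = ((v / kap / N : ℝ) : ℂ) := by push_cast; rfl
    rw [e, sub_re, re_ofReal_mul, I_re] at this
    simp at this
  have hs : (saddle N v)⁻¹ = N ^ 2 / kap * (1 - (v : ℂ) / kap / N * I)⁻¹ := by
    rw [saddle_eq hN, mul_inv, inv_div]
  have h2 : (N : ℂ) * kap * ((1 - (v : ℂ) / kap / N * I)⁻¹ - 1)
      = v * I * (1 - (v : ℂ) / kap / N * I)⁻¹ := by
    have h := mul_inv_cancel₀ hr0
    generalize (1 - (v : ℂ) / kap / N * I)⁻¹ = r at h ⊢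
    field_simp at h
    linear_combination h
  have hkk : (π : ℂ) ^ 2 = 6 * kap ^ 2 := by
    have := kap_sq
    have h : π ^ 2 = 6 * kap ^ 2 := by linarith
    exact_mod_cast h
  rw [expo]
  simp only [mul_inv, hs, ofReal_natCast, ofReal_mul, ofReal_ofNat, hkk]
  rw [← mul_assoc (2 : ℂ) (t : ℂ)]
  push_cast
  exact expo_algebra hk hN' htc h2

lemma integral_exp_int_mul_I (m : ℤ) :
    ∫ φ in -π..π, exp (m * φ * I) = if m = 0 then 2 * (π : ℂ) else 0 := by
  split_ifs with h
  · subst h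
    simp
    ring
  · have hc : (m : ℂ) * I ≠ 0 := mul_ne_zero (Int.cast_ne_zero.mpr h) I_ne_zero
    have e : ∀ φ : ℝ, exp (m * φ * I) = exp (m * I * φ) := fun φ => by
      congr 1
      ring
    simp only [e]
    rw [integral_exp_mul_complex hc]
    have : exp (m * I * (π : ℝ)) = exp (m * I * (-π : ℝ)) := by
      rw [exp_eq_exp_iff_exists_int]
      exact ⟨m, by push_cast; ring⟩
    rw [this, sub_self, zero_div]

lemma norm_exp_neg_sub_mul_I (s φ : ℝ) : ‖exp (-((s : ℂ) - φ * I))‖ = Real.exp (-s) := by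
  rw [norm_exp]
  simp

lemma norm_sum_pow_Nhook_le (t : ℕ) {T : ℂ} (hT : ‖T‖ ≤ 1) (n : ℕ) :
    ‖∑ P : n.Partition, T ^ Nhook t P‖ ≤ Fintype.card n.Partition := by
  refine (norm_sum_le _ _).trans ?_
  refine (Finset.sum_le_card_nsmul _ _ 1 fun P _ => ?_).trans (by simp)
  rw [norm_pow]
  exact pow_le_one₀ (norm_nonneg _) hT

lemma continuous_hookGF_exp (t : ℕ) {T : ℂ} (hT : ‖T‖ ≤ 1) {s : ℝ} (hs : 0 < s) :
    Continuous fun φ : ℝ => hookGF t T (exp (-((s : ℂ) - φ * I))) := by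
  have hlt : Real.exp (-s) < 1 :=
    (Real.exp_lt_exp.mpr (by linarith : -s < 0)).trans_eq Real.exp_zero
  have e : (fun φ : ℝ => hookGF t T (exp (-((s : ℂ) - φ * I))))
      = fun φ : ℝ => ∑' n : ℕ, (∑ P : n.Partition, T ^ Nhook t P) * exp (-((s : ℂ) - φ * I)) ^ n :=
    funext fun φ => (hasSum_hookGF t hT (by rwa [norm_exp_neg_sub_mul_I])).tsum_eq.symm
  rw [e]
  refine continuous_tsum (fun n => by fun_prop)
    (summable_card_mul_pow (Real.exp_pos (-s)).le hlt) fun n φ => ?_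
  rw [norm_mul, norm_pow, norm_exp_neg_sub_mul_I]
  exact mul_le_mul_of_nonneg_right (norm_sum_pow_Nhook_le t hT n) (by positivity)

lemma integral_hookGF (t : ℕ) {T : ℂ} (hT : ‖T‖ ≤ 1) {s : ℝ} (hs : 0 < s) (n : ℕ) :
    ∫ φ in -π..π, hookGF t T (exp (-((s : ℂ) - φ * I))) * exp (-(n * φ * I))
      = 2 * π * (∑ P : n.Partition, T ^ Nhook t P) * exp (-(n * s)) := by
  have hlt : Real.exp (-s) < 1 :=
    (Real.exp_lt_exp.mpr (by linarith : -s < 0)).trans_eq Real.exp_zero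
  set a : ℕ → ℂ := fun n => ∑ P : n.Partition, T ^ Nhook t P with ha
  have h := intervalIntegral.hasSum_integral_of_dominated_convergence (μ := MeasureTheory.volume)
    (a := -π) (b := π)
    (F := fun (k : ℕ) (φ : ℝ) => a k * exp (-((s : ℂ) - φ * I)) ^ k * exp (-(n * φ * I)))
    (f := fun φ : ℝ => hookGF t T (exp (-((s : ℂ) - φ * I))) * exp (-(n * φ * I)))
    (bound := fun k _ => (Fintype.card k.Partition : ℝ) * Real.exp (-s) ^ k)
    (fun k => (by fun_prop : Continuous _).aestronglyMeasurable)
    (fun k => Eventually.of_forall fun φ _ => by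
      have h1 : ‖exp (-(n * φ * I))‖ = 1 := by
        rw [norm_exp]
        simp
      rw [norm_mul, norm_mul, h1, mul_one, norm_pow, norm_exp_neg_sub_mul_I]
      exact mul_le_mul_of_nonneg_right (norm_sum_pow_Nhook_le t hT k) (by positivity))
    (Eventually.of_forall fun _ _ => summable_card_mul_pow (Real.exp_pos (-s)).le hlt)
    (intervalIntegrable_const)
    (Eventually.of_forall fun φ _ =>
      (hasSum_hookGF t hT (by rwa [norm_exp_neg_sub_mul_I])).mul_right _)
  have e : (fun k : ℕ => ∫ φ in -π..π, a k * exp (-((s : ℂ) - φ * I)) ^ k * exp (-(n * φ * I)))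
      = fun k => if k = n then 2 * π * a n * exp (-(n * s)) else 0 := by
    funext k
    have e1 : ∀ φ : ℝ, a k * exp (-((s : ℂ) - φ * I)) ^ k * exp (-(n * φ * I))
        = (a k * exp (-(k * s))) * exp (((k - n : ℤ) : ℂ) * φ * I) := fun φ => by
      rw [← exp_nat_mul, mul_assoc, mul_assoc (a k), ← exp_add, ← exp_add]
      congr 2
      push_cast
      ring
    simp only [e1]
    rw [intervalIntegral.integral_const_mul, integral_exp_int_mul_I]
    have : ((k : ℤ) - n = 0) ↔ k = n := by omega
    simp only [this]
    split_ifs with hk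
    · subst hk
      ring
    · simp
  rw [e] at h
  exact h.unique (hasSum_ite_eq n _)

lemma exp_expo (t : ℕ) (ht : 1 ≤ t) {θ N : ℝ} (hN : 0 < N) (hθ : 2 * |θ| ≤ N) (v : ℝ) :
    exp (expo t θ N v) =
      hookGF t (exp ((θ / N : ℝ) * I))
          (exp (-(((kap / N ^ 2 : ℝ) : ℂ) - ((v / N ^ 3 : ℝ) : ℂ) * I))) * exp (-(N * v * I))
        * exp (-logPart ((kap / N ^ 2 : ℝ) : ℂ) - I * (θ / N * (N ^ 2 / kap - t / 2))) := by
  have hk := kap_pos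
  have hz : ‖exp ((θ / N : ℝ) * I) - 1‖ ≤ 1 / 2 := by
    refine (norm_exp_mul_I_sub_one_le _).trans ?_
    rw [abs_div, abs_of_pos hN, div_le_div_iff₀ hN two_pos]
    linarith
  have h := hookGF_exp t ht hz (by rw [add_sub_cancel, norm_exp_ofReal_mul_I])
    (w := saddle N v) (by rw [saddle_re]; positivity)
  rw [add_sub_cancel, saddle] at h
  rw [h, expo, ← exp_add, ← exp_add, saddle]
  congr 1
  ring

lemma integral_exp_expo (t : ℕ) (ht : 1 ≤ t) {θ N : ℝ} (hN : 0 < N) (hθ : 2 * |θ| ≤ N) {n : ℕ}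
    (hn : N ^ 4 = n) :
    ∫ v in -(π * N ^ 3)..π * N ^ 3, exp (expo t θ N v)
      = N ^ 3 * (2 * π * (∑ P : n.Partition, exp ((θ / N : ℝ) * I) ^ Nhook t P)
          * exp (-(n * (kap / N ^ 2 : ℝ))))
        * exp (-logPart ((kap / N ^ 2 : ℝ) : ℂ) - I * (θ / N * (N ^ 2 / kap - t / 2))) := by
  have hk := kap_pos
  have hN3 : N ^ 3 ≠ 0 := by positivity
  have hT : ‖exp ((θ / N : ℝ) * I)‖ ≤ 1 := by rw [norm_exp_ofReal_mul_I]
  have h := integral_hookGF t hT (s := kap / N ^ 2) (by positivity) n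
  have e : ∀ v : ℝ, exp (-(N * v * I)) = exp (-(n * ((v / N ^ 3 : ℝ) : ℂ) * I)) := fun v => by
    have : (n : ℂ) = (N : ℂ) ^ 4 := by exact_mod_cast hn.symm
    have hN' : (N : ℂ) ≠ 0 := ofReal_ne_zero.mpr hN.ne'
    rw [this]
    congr 2
    push_cast
    field_simp
  simp only [exp_expo t ht hN hθ, e]
  rw [intervalIntegral.integral_mul_const,
    intervalIntegral.integral_comp_div (fun φ : ℝ => hookGF t (exp ((θ / N : ℝ) * I))
      (exp (-(((kap / N ^ 2 : ℝ) : ℂ) - (φ : ℂ) * I))) * exp (-(n * (φ : ℂ) * I))) hN3,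
    neg_div, mul_div_cancel_right₀ _ hN3, h, real_smul]
  push_cast
  rfl

lemma continuous_exp_expo (t : ℕ) (ht : 1 ≤ t) {θ N : ℝ} (hN : 0 < N) (hθ : 2 * |θ| ≤ N) :
    Continuous fun v => exp (expo t θ N v) := by
  have hk := kap_pos
  simp only [exp_expo t ht hN hθ]
  have h := (continuous_hookGF_exp t (T := exp ((θ / N : ℝ) * I))
    (by rw [norm_exp_ofReal_mul_I]) (s := kap / N ^ 2) (by positivity)).comp
    (continuous_id.div_const (N ^ 3))
  exact (h.mul (by fun_prop)).mul continuous_const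

lemma tendsto_integral_exp_expo (t : ℕ) (ht : 1 ≤ t) (θ : ℝ) :
    Tendsto (fun N : ℝ => ∫ v in -(π * N ^ 3)..π * N ^ 3, exp (expo t θ N v)) atTop
      (nhds ((π * kap) ^ (1 / 2 : ℂ) * exp (-(θ ^ 2 * (1 - 1 / kap ^ 2) / (4 * kap))))) := by
  have hk := kap_pos
  have hk' : (kap : ℂ) ≠ 0 := ofReal_ne_zero.mpr hk.ne'
  have hlim : ∫ v : ℝ, exp (-((v : ℂ) ^ 2 / kap + v * θ / kap ^ 2 + θ ^ 2 / (4 * kap)))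
      = (π * kap) ^ (1 / 2 : ℂ) * exp (-(θ ^ 2 * (1 - 1 / kap ^ 2) / (4 * kap))) := by
    have h := integral_cexp_quadratic (b := ((-kap⁻¹ : ℝ) : ℂ)) (by
      rw [ofReal_re, neg_lt_zero]; positivity) (-θ / kap ^ 2) (-θ ^ 2 / (4 * kap))
    convert h using 2
    · funext v
      congr 1
      push_cast
      field_simp
      ring
    · congr 1
      push_cast
      field_simp
    · congr 1
      push_cast
      field_simp
      ring
  rw [← hlim]
  have hcongr : (fun N : ℝ => ∫ v, (Set.Ioc (-(π * N ^ 3)) (π * N ^ 3)).indicator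
      (fun v => exp (expo t θ N v)) v)
      =ᶠ[atTop] fun N : ℝ => ∫ v in -(π * N ^ 3)..π * N ^ 3, exp (expo t θ N v) := by
    filter_upwards [eventually_ge_atTop 0] with N hN
    have : 0 ≤ π * N ^ 3 := by positivity
    rw [MeasureTheory.integral_indicator measurableSet_Ioc,
      intervalIntegral.integral_of_le (by linarith)]
  refine Tendsto.congr' hcongr ?_
  refine MeasureTheory.tendsto_integral_filter_of_dominated_convergence
    (fun v => 10 ^ 9 * Real.exp (52 * θ ^ 2) * (1 + v ^ 2)⁻¹) ?_ ?_ ?_ ?_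
  · filter_upwards [eventually_gt_atTop 0, eventually_ge_atTop (2 * |θ|)] with N hN hθ
    exact (continuous_exp_expo t ht hN hθ).aestronglyMeasurable.indicator measurableSet_Ioc
  · filter_upwards [eventually_ge_atTop 2, eventually_ge_atTop (2 * |θ|)] with N hN hθ
    refine Eventually.of_forall fun v => ?_
    by_cases hv : v ∈ Set.Ioc (-(π * N ^ 3)) (π * N ^ 3)
    · rw [Set.indicator_of_mem hv]
      exact norm_exp_expo_le t ht hN hθ (abs_le.mpr ⟨hv.1.le, hv.2⟩)
    · rw [Set.indicator_of_notMem hv, norm_zero]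
      positivity
  · exact integrable_inv_one_add_sq.const_mul _
  · refine Eventually.of_forall fun v => ?_
    refine Tendsto.congr' ?_ ((continuous_exp.tendsto _).comp (tendsto_expo t ht θ v))
    filter_upwards [eventually_ge_atTop 1, eventually_ge_atTop (|v| + 1)] with N hN hNv
    have h1 : |v| < π * N ^ 3 := by
      have : N ≤ N ^ 3 := le_self_pow₀ hN (by norm_num)
      nlinarith [Real.pi_gt_three]
    have hm : v ∈ Set.Ioc (-(π * N ^ 3)) (π * N ^ 3) := ⟨(abs_lt.mp h1).1, (abs_lt.mp h1).2.le⟩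
    rw [Set.indicator_of_mem hm]
    rfl

lemma tendsto_sqrt_sqrt : Tendsto (fun n : ℕ => √√(n : ℝ)) atTop atTop :=
  Real.tendsto_sqrt_atTop.comp (Real.tendsto_sqrt_atTop.comp tendsto_natCast_atTop_atTop)

lemma sqrt_sqrt_pow_four (n : ℕ) : √√(n : ℝ) ^ 4 = n := by
  rw [show 4 = 2 * 2 from rfl, pow_mul, Real.sq_sqrt (Real.sqrt_nonneg _),
    Real.sq_sqrt (Nat.cast_nonneg n)]

lemma tendsto_twisted_average (t : ℕ) (ht : 1 ≤ t) (θ : ℝ) :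
    Tendsto (fun n : ℕ => (∑ P : n.Partition, exp ((θ / √√(n : ℝ) : ℝ) * I) ^ Nhook t P)
        / (Fintype.card n.Partition : ℂ)
        * exp (-(I * (θ / √√(n : ℝ) * (√√(n : ℝ) ^ 2 / kap - t / 2)))))
      atTop (nhds (exp (-(θ ^ 2 * (1 - 1 / kap ^ 2) / (4 * kap))))) := by
  have hk := kap_pos
  have hc : ((π : ℂ) * kap) ^ (1 / 2 : ℂ) ≠ 0 := by
    rw [Ne, cpow_eq_zero_iff, not_and_or]
    exact Or.inl (mul_ne_zero (ofReal_ne_zero.mpr Real.pi_ne_zero) (ofReal_ne_zero.mpr hk.ne'))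
  have h1 := tendsto_integral_exp_expo t ht θ
  have h0 := tendsto_integral_exp_expo t ht 0
  have e0 : ((π : ℂ) * kap) ^ (1 / 2 : ℂ)
      * exp (-(((0 : ℝ) : ℂ) ^ 2 * (1 - 1 / kap ^ 2) / (4 * kap)))
      = ((π : ℂ) * kap) ^ (1 / 2 : ℂ) := by simp
  rw [e0] at h0
  have h := (h1.div h0 hc).comp tendsto_sqrt_sqrt
  rw [mul_div_cancel_left₀ _ hc] at h
  refine h.congr' ?_
  filter_upwards [tendsto_sqrt_sqrt.eventually_ge_atTop (2 * |θ|),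
    tendsto_sqrt_sqrt.eventually_gt_atTop 0] with n hθ hN
  have hn := sqrt_sqrt_pow_four n
  simp only [Function.comp_apply, Pi.div_apply]
  rw [integral_exp_expo t ht hN hθ hn, integral_exp_expo t ht hN (by simp) hn]
  have hN' : ((√√(n : ℝ) : ℝ) : ℂ) ≠ 0 := ofReal_ne_zero.mpr hN.ne'
  have hpi : (π : ℂ) ≠ 0 := ofReal_ne_zero.mpr Real.pi_ne_zero
  have hcard : (Fintype.card n.Partition : ℂ) ≠ 0 := Nat.cast_ne_zero.mpr Fintype.card_ne_zero
  simp only [zero_div, ofReal_zero, zero_mul, mul_zero, exp_zero, one_pow, neg_zero,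
    Finset.sum_const, Finset.card_univ, nsmul_eq_mul, mul_one, sub_eq_add_neg (-logPart _), exp_add]
  have := exp_ne_zero (-(n * ((kap / √√(n : ℝ) ^ 2 : ℝ) : ℂ)))
  have := exp_ne_zero (-logPart ((kap / √√(n : ℝ) ^ 2 : ℝ) : ℂ))
  field_simp

open MeasureTheory ProbabilityTheory in
/-- If the characteristic functions of the empirical laws of real statistics on finite types
converge to that of the standard normal law, then so do the distribution functions. -/
lemma tendsto_card_filter_le_of_tendsto_charFun {α : ℕ → Type*} [∀ n, Fintype (α n)]
    [∀ n, Nonempty (α n)] (X : ∀ n, α n → ℝ)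
    (h : ∀ ξ : ℝ, Tendsto (fun n => (∑ a, exp (ξ * X n a * I)) / (Fintype.card (α n) : ℂ)) atTop
      (nhds (exp (-(ξ ^ 2 / 2))))) (x : ℝ) :
    Tendsto (fun n => ((Finset.univ.filter fun a => X n a ≤ x).card : ℝ) / Fintype.card (α n)) atTop
      (nhds ((1 / Real.sqrt (2 * π)) * ∫ u in Set.Iic x, Real.exp (-u ^ 2 / 2))) := by
  set ν : ℕ → Measure ℝ := fun n =>
    ((Fintype.card (α n) : ENNReal)⁻¹) • ∑ a, Measure.dirac (X n a) with hν
  have hprob : ∀ n, IsProbabilityMeasure (ν n) := fun n => ⟨by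
    simp only [hν, Measure.smul_apply, Measure.coe_finsetSum, Finset.sum_apply, measure_univ,
      Finset.sum_const, Finset.card_univ, smul_eq_mul, nsmul_eq_mul, mul_one]
    exact ENNReal.inv_mul_cancel (Nat.cast_ne_zero.mpr Fintype.card_ne_zero)
      (ENNReal.natCast_ne_top _)⟩
  let μs : ℕ → ProbabilityMeasure ℝ := fun n => ⟨ν n, hprob n⟩
  let μ : ProbabilityMeasure ℝ := ⟨gaussianReal 0 1, inferInstance⟩
  have hlim : Tendsto μs atTop (nhds μ) := by
    refine ProbabilityMeasure.tendsto_of_tendsto_charFun fun ξ => ?_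
    have e1 : charFun (μ : Measure ℝ) ξ = exp (-(ξ ^ 2 / 2)) := by
      refine (charFun_gaussianReal ξ).trans ?_
      simp
    rw [e1]
    refine (h ξ).congr fun n => ?_
    change _ = charFun (ν n) ξ
    rw [charFun_apply_real, hν, integral_smul_measure, integral_finsetSum_measure]
    · simp only [integral_dirac, ENNReal.toReal_inv, ENNReal.toReal_natCast, real_smul]
      push_cast
      ring
    · exact fun a _ => integrable_dirac (by simp)
  have hnull : (μ : Measure ℝ) (frontier (Set.Iic x)) = 0 := by
    rw [frontier_Iic]
    have := nullSingletonClass_gaussianReal (μ := 0) one_ne_zero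
    exact measure_singleton (μ := gaussianReal 0 1) x
  have hconv := (ENNReal.tendsto_toReal (measure_ne_top (μ : Measure ℝ) (Set.Iic x))).comp
    (ProbabilityMeasure.tendsto_measure_of_null_frontier_of_tendsto' hlim hnull)
  have e2 : ((μ : Measure ℝ) (Set.Iic x)).toReal
      = (1 / Real.sqrt (2 * π)) * ∫ u in Set.Iic x, Real.exp (-u ^ 2 / 2) := by
    change (gaussianReal 0 1 (Set.Iic x)).toReal = _
    rw [gaussianReal_apply_eq_integral 0 one_ne_zero, ENNReal.toReal_ofReal
      (integral_nonneg fun u => gaussianPDFReal_nonneg _ _ _)]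
    simp only [gaussianPDFReal, integral_const_mul]
    simp
  rw [e2] at hconv
  refine hconv.congr fun n => ?_
  change (ν n (Set.Iic x)).toReal = _
  simp only [hν, Measure.smul_apply, Measure.coe_finsetSum, Finset.sum_apply, smul_eq_mul,
    Measure.dirac_apply' _ measurableSet_Iic, Set.indicator_apply, Set.mem_Iic, Pi.one_apply,
    Finset.sum_boole, ENNReal.toReal_mul, ENNReal.toReal_inv, ENNReal.toReal_natCast]
  rw [div_eq_inv_mul]

/-- The normalised standard deviation constant `√((π² - 6)√6 / (2π³))`. -/
noncomputable def hookSigma : ℝ := √((π ^ 2 - 6) * √6 / (2 * π ^ 3))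

lemma pi_sq_sub_six_pos : 0 < π ^ 2 - 6 := by
  nlinarith [Real.pi_gt_three]

lemma hookSigma_pos : 0 < hookSigma := by
  have := pi_sq_sub_six_pos
  unfold hookSigma
  positivity

lemma hookSigma_sq : hookSigma ^ 2 = (1 - 1 / kap ^ 2) / (2 * kap) := by
  have h6 : √6 ^ 2 = 6 := Real.sq_sqrt (by norm_num)
  have := pi_sq_sub_six_pos
  rw [hookSigma, Real.sq_sqrt (by positivity), kap_sq, kap]
  field_simp

lemma sqrt_six_mul_div_pi (n : ℕ) : √(6 * n) / π = √√(n : ℝ) ^ 2 / kap := by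
  rw [Real.sq_sqrt (Real.sqrt_nonneg _), Real.sqrt_mul (by norm_num), kap]
  field_simp

lemma sqrt_variance_eq (n : ℕ) :
    √((π ^ 2 - 6) * √(6 * n) / (2 * π ^ 3)) = hookSigma * √√(n : ℝ) := by
  have := pi_sq_sub_six_pos
  rw [hookSigma, ← Real.sqrt_mul (by positivity), Real.sqrt_mul (by norm_num : (0 : ℝ) ≤ 6)]
  congr 1
  ring

lemma tendsto_charFun_hook (t : ℕ) (ht : 1 ≤ t) (ξ : ℝ) :
    Tendsto (fun n : ℕ => (∑ P : n.Partition, exp (ξ * (((Nhook t P : ℝ)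
        - (√√(n : ℝ) ^ 2 / kap - t / 2)) / (hookSigma * √√(n : ℝ)) : ℝ) * I))
        / (Fintype.card n.Partition : ℂ)) atTop (nhds (exp (-(ξ ^ 2 / 2)))) := by
  have hk := kap_pos
  have hσ := hookSigma_pos
  have h := tendsto_twisted_average t ht (ξ / hookSigma)
  have e : -((((ξ / hookSigma : ℝ) : ℂ)) ^ 2 * (1 - 1 / kap ^ 2) / (4 * kap))
      = -((ξ : ℂ) ^ 2 / 2) := by
    have : -((ξ / hookSigma) ^ 2 * (1 - 1 / kap ^ 2) / (4 * kap)) = -(ξ ^ 2 / 2) := by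
      have hs := hookSigma_sq
      have : (1 - 1 / kap ^ 2) = hookSigma ^ 2 * (2 * kap) := by
        rw [hs]
        field_simp
      rw [this]
      field_simp
      ring
    exact_mod_cast congrArg ofReal this
  rw [e] at h
  refine h.congr fun n => ?_
  rw [div_mul_eq_mul_div, Finset.sum_mul]
  congr 1
  refine Finset.sum_congr rfl fun P _ => ?_
  rw [← exp_nat_mul, ← exp_add]
  congr 1
  push_cast
  ring

end PartitionHooks

/-- (Griffin–Ono–Tsai) The number of `t`-hooks among all partitions of `n` is
asymptotically normally distributed with mean `√(6n)/π - t/2` and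
variance `(π² - 6)√(6n)/(2π³)`. -/
theorem stmt1 (t : ℕ) (ht : 1 ≤ t) (x : ℝ) :
    Filter.Tendsto (fun n : ℕ =>
      (((Finset.univ : Finset (Nat.Partition n)).filter (fun P => (Nhook t P : ℝ) ≤
          (Real.sqrt (6*n)/π - t/2)
            + x * Real.sqrt ((π^2 - 6) * Real.sqrt (6*n) / (2*π^3)))).card : ℝ)
        / (Fintype.card (Nat.Partition n) : ℝ))
      Filter.atTop
      (nhds ((1/Real.sqrt (2*π)) * ∫ u in Set.Iic x, Real.exp (-u^2/2))) := by
  have h := PartitionHooks.tendsto_card_filter_le_of_tendsto_charFun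
    (fun (n : ℕ) (P : n.Partition) =>
      ((Nhook t P : ℝ) - (√√(n : ℝ) ^ 2 / PartitionHooks.kap - t / 2))
      / (PartitionHooks.hookSigma * √√(n : ℝ)))
    (PartitionHooks.tendsto_charFun_hook t ht) x
  refine h.congr' ?_
  filter_upwards [PartitionHooks.tendsto_sqrt_sqrt.eventually_gt_atTop 0] with n hn
  have hσ := PartitionHooks.hookSigma_pos
  simp only [PartitionHooks.sqrt_six_mul_div_pi, PartitionHooks.sqrt_variance_eq]
  congr 3
  ext P
  simp only [Finset.mem_filter, Finset.mem_univ, true_and]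
  rw [div_le_iff₀ (by positivity), sub_le_iff_le_add']
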